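/- arXiv:2603.28349 — 3 statements merged into one kernel-verified Lean document; each statement's English description precedes it below -/
import Mathlib

section
/- Let A be an MPS tensor (bond dimension D, physical dimension d) that is injective with injectivity length L, and suppose A admits positive definite transfer fixed points ρ_L, ρ_R. Let o be a k-site operator (k ≥ 1), let ε ∈ ℂ, and let N be an integer with N > 2L + 2k − 1. Then the matrix product state ψ_N satisfies O_N ψ_N = (N·ε) ψ_N if and only if there exists a family B = (B^{i_1…i_{k−1}})_{(i_1,…,i_{k−1}) ∈ (Fin d)^{k−1}} of D×D complex matrices satisfying the local telescoping equation for (A, o, ε). -/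
open Matrix
open scoped ComplexOrder

/-- Cyclic shift of a site index: `cyc a t` is `a + t (mod N)`. -/
def cyc {N : ℕ} (a : Fin N) (t : ℕ) : Fin N :=
  ⟨(a.val + t) % N, Nat.mod_lt _ (Nat.lt_of_le_of_lt (Nat.zero_le _) a.isLt)⟩

/-- Ordered product `A^{i_1} ⋯ A^{i_m}`. -/
noncomputable def prodA {d D m : ℕ} (A : Fin d → Matrix (Fin D) (Fin D) ℂ)
    (i : Fin m → Fin d) : Matrix (Fin D) (Fin D) ℂ :=
  (List.ofFn fun t => A (i t)).prod

/-- Matrix product state on `N` cyclic sites: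
`ψ_N(i_1,…,i_N) = Tr(A^{i_1} ⋯ A^{i_N})`. -/
noncomputable def mps {d D : ℕ} (A : Fin d → Matrix (Fin D) (Fin D) ℂ) (N : ℕ) :
    (Fin N → Fin d) → ℂ :=
  fun i => (prodA A i).trace

/-- A `k`-site operator `o` acting on sites `n, n+1, …, n+k-1 (mod N)` of a
periodic chain of `N` sites, as a matrix on the full configuration space. -/
noncomputable def localOp {d k N : ℕ}
    (o : Matrix (Fin k → Fin d) (Fin k → Fin d) ℂ) (n : Fin N) :
    Matrix (Fin N → Fin d) (Fin N → Fin d) ℂ :=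
  Matrix.of fun x y =>
    o (fun t => x (cyc n t.val)) (fun t => y (cyc n t.val)) *
      (if ∀ m : Fin N, (∀ t : Fin k, m ≠ cyc n t.val) → x m = y m then 1 else 0)

/-- `O_N = Σ_{n=1}^N o_n`, the sum of all translates of a `k`-site operator. -/
noncomputable def opSum {d k N : ℕ}
    (o : Matrix (Fin k → Fin d) (Fin k → Fin d) ℂ) :
    Matrix (Fin N → Fin d) (Fin N → Fin d) ℂ :=
  ∑ n : Fin N, localOp o n

/-- `A` is injective with injectivity length `L`: the map
`Γ_L : X ↦ (Tr(X A^{i_1} ⋯ A^{i_L}))_{i}` is injective. -/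
noncomputable def InjectiveLen {d D : ℕ} (A : Fin d → Matrix (Fin D) (Fin D) ℂ)
    (L : ℕ) : Prop :=
  Function.Injective fun X : Matrix (Fin D) (Fin D) ℂ =>
    fun i : Fin L → Fin d => (X * prodA A i).trace

/-- `ρL, ρR` are positive definite fixed points of the transfer operator of `A`. -/
def TransferFixedPoints {d D : ℕ} (A : Fin d → Matrix (Fin D) (Fin D) ℂ)
    (ρL ρR : Matrix (Fin D) (Fin D) ℂ) : Prop :=
  ρL.PosDef ∧ ρR.PosDef ∧
    (∑ i, (A i)ᴴ * ρL * A i) = ρL ∧ (∑ i, A i * ρR * (A i)ᴴ) = ρR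

/-- `B` satisfies the local telescoping equation for `(A, o, ε)`, where `o` is a
`(k+1)`-site operator and `B` is a family of matrices indexed by `k`-tuples:
`Σ_j o^{i}_{j} A^{j_0}⋯A^{j_k} − ε A^{i_0}⋯A^{i_k}
  = A^{i_0} B^{i_1…i_k} − B^{i_0…i_{k-1}} A^{i_k}`. -/
noncomputable def Telescopes {d D k : ℕ} (A : Fin d → Matrix (Fin D) (Fin D) ℂ)
    (o : Matrix (Fin (k+1) → Fin d) (Fin (k+1) → Fin d) ℂ) (ε : ℂ)
    (B : (Fin k → Fin d) → Matrix (Fin D) (Fin D) ℂ) : Prop :=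
  ∀ i : Fin (k+1) → Fin d,
    (∑ j : Fin (k+1) → Fin d, o i j • prodA A j) - ε • prodA A i
      = A (i 0) * B (fun t => i t.succ) - B (fun t => i t.castSucc) * A (i (Fin.last k))

section WordProducts

variable {α : Type*} {D : ℕ}

/-- The product of the matrices `A a` along a word. -/
noncomputable def wordProd (A : α → Matrix (Fin D) (Fin D) ℂ) (w : List α) :
    Matrix (Fin D) (Fin D) ℂ :=
  (w.map A).prod

@[simp] lemma wordProd_nil (A : α → Matrix (Fin D) (Fin D) ℂ) : wordProd A [] = 1 := by
  simp [wordProd]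

@[simp] lemma wordProd_cons (A : α → Matrix (Fin D) (Fin D) ℂ) (a : α) (w : List α) :
    wordProd A (a :: w) = A a * wordProd A w := by
  simp [wordProd]

@[simp] lemma wordProd_append (A : α → Matrix (Fin D) (Fin D) ℂ) (v w : List α) :
    wordProd A (v ++ w) = wordProd A v * wordProd A w := by
  simp [wordProd]

/-- The word products of length `n` span the full matrix algebra. -/
def WordsSpan (A : α → Matrix (Fin D) (Fin D) ℂ) (n : ℕ) : Prop :=
  Submodule.span ℂ {M | ∃ w : List α, w.length = n ∧ wordProd A w = M} = ⊤

lemma WordsSpan.eq_of_eqOn {A : α → Matrix (Fin D) (Fin D) ℂ} {n : ℕ} (h : WordsSpan A n)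
    {E : Type*} [AddCommGroup E] [Module ℂ E] {f g : Matrix (Fin D) (Fin D) ℂ →ₗ[ℂ] E}
    (hfg : ∀ w : List α, w.length = n → f (wordProd A w) = g (wordProd A w)) : f = g := by
  refine LinearMap.ext_on h ?_
  rintro _ ⟨w, hw, rfl⟩
  exact hfg w hw

lemma WordsSpan.exists_wordProd_apply_ne_zero {A : α → Matrix (Fin D) (Fin D) ℂ} {n : ℕ}
    (h : WordsSpan A n) {E : Type*} [AddCommGroup E] [Module ℂ E]
    {f : Matrix (Fin D) (Fin D) ℂ →ₗ[ℂ] E} (hf : f ≠ 0) :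
    ∃ w : List α, w.length = n ∧ f (wordProd A w) ≠ 0 := by
  by_contra! hw
  exact hf (h.eq_of_eqOn (g := 0) (by simpa using hw))

lemma WordsSpan.succ [Fintype α] {A G : α → Matrix (Fin D) (Fin D) ℂ}
    (hG : ∑ a, G a * A a = 1) {n : ℕ} (h : WordsSpan A n) : WordsSpan A (n + 1) := by
  refine (Submodule.eq_top_iff').2 fun X => ?_
  have key : ∀ a : α, ∀ Y : Matrix (Fin D) (Fin D) ℂ, Y * A a ∈
      Submodule.span ℂ {M | ∃ w : List α, w.length = n + 1 ∧ wordProd A w = M} := by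
    intro a Y
    have hY : Y ∈ Submodule.span ℂ {M | ∃ w : List α, w.length = n ∧ wordProd A w = M} := by
      rw [h]; trivial
    induction hY using Submodule.span_induction with
    | mem Y hY =>
      obtain ⟨w, hw, rfl⟩ := hY
      exact Submodule.subset_span ⟨w ++ [a], by simp [hw], by simp⟩
    | zero => simp
    | add Y Z _ _ hY hZ => rw [add_mul]; exact add_mem hY hZ
    | smul c Y _ hY => rw [smul_mul_assoc]; exact Submodule.smul_mem _ c hY
  have hX : X = ∑ a, (X * G a) * A a := by
    simp_rw [mul_assoc, ← Finset.mul_sum, hG, mul_one]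
  rw [hX]
  exact sum_mem fun a _ => key a _

lemma WordsSpan.mono [Fintype α] {A G : α → Matrix (Fin D) (Fin D) ℂ}
    (hG : ∑ a, G a * A a = 1) {m n : ℕ} (h : WordsSpan A m) (hmn : m ≤ n) : WordsSpan A n := by
  induction n, hmn using Nat.le_induction with
  | base => exact h
  | succ n _ ih => exact ih.succ hG

/-- Sum over all positions of a window of `k + 1` letters inside an open word, where the letters
of the window contribute `C` and all the others contribute `A`. -/
noncomputable def openSum (A : α → Matrix (Fin D) (Fin D) ℂ)
    (C : List α → Matrix (Fin D) (Fin D) ℂ) (k : ℕ) (w : List α) : Matrix (Fin D) (Fin D) ℂ :=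
  ∑ n ∈ Finset.range (w.length - k),
    wordProd A (w.take n) * C ((w.drop n).take (k + 1)) * wordProd A (w.drop (n + (k + 1)))

/-- The trace of a word whose first `k + 1` letters contribute `C`. -/
noncomputable def headTrace (A : α → Matrix (Fin D) (Fin D) ℂ)
    (C : List α → Matrix (Fin D) (Fin D) ℂ) (k : ℕ) (w : List α) : ℂ :=
  (C (w.take (k + 1)) * wordProd A (w.drop (k + 1))).trace

/-- Sum over all positions of a window of `k + 1` letters inside a cyclic word. -/
noncomputable def ringSum (A : α → Matrix (Fin D) (Fin D) ℂ)
    (C : List α → Matrix (Fin D) (Fin D) ℂ) (k : ℕ) (w : List α) : ℂ :=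
  ∑ n ∈ Finset.range w.length, headTrace A C k (w.rotate n)

variable {A G : α → Matrix (Fin D) (Fin D) ℂ} {C B : List α → Matrix (Fin D) (Fin D) ℂ} {k : ℕ}

lemma openSum_append_left {u : List α} (hu : u.length = k + 1) (w : List α) :
    openSum A C k (u ++ w)
      = wordProd A (u.take 1) * openSum A C k (u.drop 1 ++ w) + C u * wordProd A w := by
  obtain ⟨a, v, rfl⟩ := List.exists_cons_of_length_eq_add_one hu
  have hv : v.length = k := by simpa using hu
  have h1 : (a :: v ++ w).length - k = w.length + 1 := by simp; omega
  have h2 : (v ++ w).length - k = w.length := by simp; omega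
  simp only [openSum, List.take_succ_cons, List.take_zero, List.drop_succ_cons, List.drop_zero,
    h1, h2, Finset.sum_range_succ', Finset.mul_sum]
  congr 1
  · refine Finset.sum_congr rfl fun n _ => ?_
    rw [show n + 1 + (k + 1) = n + (k + 1) + 1 by ring]
    simp [mul_assoc]
  · simp [← hv]

lemma openSum_append_right {u : List α} (hu : u.length = k + 1) (w : List α) :
    openSum A C k (w ++ u)
      = openSum A C k (w ++ u.take k) * wordProd A (u.drop k) + wordProd A w * C u := by
  have h1 : (w ++ u).length - k = w.length + 1 := by simp; omega
  have h2 : (w ++ u.take k).length - k = w.length := by simp; omega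
  simp only [openSum, h1, h2, Finset.sum_range_succ, Finset.sum_mul]
  congr 1
  · refine Finset.sum_congr rfl fun n hn => ?_
    have hn : n < w.length := by simpa using hn
    have hw : w ++ u = (w ++ u.take k) ++ u.drop k := by simp
    have hlen : (w ++ u.take k).length = w.length + k := by simp [hu]
    rw [hw, List.take_append_of_le_length (by omega) (l₁ := w ++ u.take k),
      List.drop_append_of_le_length (by omega) (l₁ := w ++ u.take k),
      List.drop_append_of_le_length (by omega) (l₁ := w ++ u.take k),
      List.take_append_of_le_length (l₁ := (w ++ u.take k).drop n)
        (by rw [List.length_drop]; omega), wordProd_append]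
    simp only [mul_assoc]
  · simp [← hu]

lemma headTrace_rotate_append (w z : List α) {n : ℕ} (hn : n + (k + 1) ≤ w.length) :
    headTrace A C k ((w ++ z).rotate n)
      = ((wordProd A (w.take n) * C ((w.drop n).take (k + 1)) * wordProd A (w.drop (n + (k + 1))))
          * wordProd A z).trace := by
  rw [List.rotate_eq_drop_append_take (by simp; omega),
    List.drop_append_of_le_length (by omega), List.take_append_of_le_length (by omega), headTrace,
    List.append_assoc, List.take_append_of_le_length (by simp; omega),
    List.drop_append_of_le_length (by simp; omega), wordProd_append, wordProd_append,
    List.drop_drop, ← mul_assoc, ← mul_assoc, Matrix.trace_mul_comm]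
  simp only [mul_assoc]

/-- A cyclic window sum splits into two open window sums over overlapping arcs. -/
lemma ringSum_append {q x p z : List α} (hq : q.length = k) (hp : p.length = k) :
    ringSum A C k (q ++ x ++ p ++ z)
      = (openSum A C k (q ++ x ++ p) * wordProd A z).trace
        + (openSum A C k (p ++ z ++ q) * wordProd A x).trace := by
  have h1 : (q ++ x ++ p).length - k = x.length + k := by simp; omega
  have h2 : (p ++ z ++ q).length - k = z.length + k := by simp; omega
  have h3 : (q ++ x ++ p ++ z).length = (x.length + k) + (z.length + k) := by simp; omega
  rw [ringSum, h3, Finset.sum_range_add, openSum, openSum, h1, h2, Finset.sum_mul, Finset.sum_mul,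
    Matrix.trace_sum, Matrix.trace_sum]
  congr 1
  · refine Finset.sum_congr rfl fun n hn => ?_
    have hn : n < x.length + k := by simpa using hn
    exact headTrace_rotate_append _ _ (by simp; omega)
  · refine Finset.sum_congr rfl fun n hn => ?_
    have hn : n < z.length + k := by simpa using hn
    have hrot : (q ++ x ++ p ++ z).rotate (x.length + k + n) = (p ++ z ++ q ++ x).rotate n := by
      rw [← List.rotate_rotate, show x.length + k = (q ++ x).length by simp; omega,
        show q ++ x ++ p ++ z = (q ++ x) ++ (p ++ z) by simp, List.rotate_append_length_eq]
      simp
    rw [hrot]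
    exact headTrace_rotate_append _ _ (by simp; omega)

/-- The local telescoping equation, for families indexed by words. -/
def WordTelescopes (A : α → Matrix (Fin D) (Fin D) ℂ) (C B B' : List α → Matrix (Fin D) (Fin D) ℂ)
    (k : ℕ) : Prop :=
  ∀ u : List α, u.length = k + 1 →
    C u = wordProd A (u.take 1) * B (u.drop 1) - B' (u.take k) * wordProd A (u.drop k)

lemma ringSum_eq_zero_of_telescopes (h : WordTelescopes A C B B k) {w : List α}
    (hw : k + 1 ≤ w.length) : ringSum A C k w = 0 := by
  let g : ℕ → ℂ := fun n =>
    (B ((w.rotate n).take k) * wordProd A ((w.rotate n).drop k)).trace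
  have hstep : ∀ n, headTrace A C k (w.rotate n) = g (n + 1) - g n := by
    intro n
    have hr : k + 1 ≤ (w.rotate n).length := by simpa using hw
    simp only [g, ← List.rotate_rotate w n 1]
    generalize w.rotate n = r at hr ⊢
    obtain ⟨a, s, rfl⟩ := List.exists_cons_of_ne_nil
      (List.ne_nil_of_length_pos (by omega : 0 < r.length))
    have hs : k ≤ s.length := by simpa using hr
    rw [headTrace, h _ (by simp; omega), sub_mul, Matrix.trace_sub, List.rotate_cons_succ,
      List.rotate_zero, List.take_append_of_le_length hs, List.drop_append_of_le_length hs]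
    congr 1
    · simp only [List.take_succ_cons, List.take_zero, List.drop_succ_cons, List.drop_zero,
        wordProd_append, wordProd_cons, wordProd_nil, mul_one]
      rw [mul_assoc, Matrix.trace_mul_comm, mul_assoc]
    · rw [mul_assoc, ← wordProd_append, List.take_take, min_eq_left (by omega)]
      congr 3
      rw [← List.drop_append_of_le_length (by simp; omega), List.take_append_drop]
  rw [ringSum, Finset.sum_congr rfl fun n _ => hstep n, Finset.sum_range_sub]
  simp [g]

/-- The open window sum of a word depends on its middle part, of length `m`, only through the
corresponding matrix product. -/
def MiddleLinear (A : α → Matrix (Fin D) (Fin D) ℂ) (C : List α → Matrix (Fin D) (Fin D) ℂ)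
    (k m : ℕ) : Prop :=
  ∀ q p : List α, q.length = k → p.length = k →
    ∃ Φ : Matrix (Fin D) (Fin D) ℂ →ₗ[ℂ] Matrix (Fin D) (Fin D) ℂ,
      ∀ x : List α, x.length = m → openSum A C k (q ++ x ++ p) = Φ (wordProd A x)

lemma middleLinear_of_ringSum_eq_zero {m l : ℕ} (hspan : WordsSpan A l)
    (hring : ∀ w : List α, w.length = m + l + 2 * k → ringSum A C k w = 0) :
    MiddleLinear A C k m := by
  intro q p hq hp
  have key : ∀ Z : Matrix (Fin D) (Fin D) ℂ, ∃ W : Matrix (Fin D) (Fin D) ℂ,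
      ∀ x : List α, x.length = m →
        (openSum A C k (q ++ x ++ p) * Z).trace = (wordProd A x * W).trace := by
    intro Z
    have hZ : Z ∈ Submodule.span ℂ {M | ∃ w : List α, w.length = l ∧ wordProd A w = M} := by
      rw [hspan]; trivial
    induction hZ using Submodule.span_induction with
    | mem Z hZ =>
      obtain ⟨z, hz, rfl⟩ := hZ
      refine ⟨-openSum A C k (p ++ z ++ q), fun x hx => ?_⟩
      have h0 := hring (q ++ x ++ p ++ z) (by simp; omega)
      rw [ringSum_append hq hp] at h0
      rw [mul_neg, Matrix.trace_neg, Matrix.trace_mul_comm (wordProd A x)]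
      exact eq_neg_of_add_eq_zero_left h0
    | zero => exact ⟨0, by simp⟩
    | add Y Z _ _ hY hZ =>
      obtain ⟨V, hV⟩ := hY
      obtain ⟨W, hW⟩ := hZ
      exact ⟨V + W, fun x hx => by
        rw [mul_add, mul_add, Matrix.trace_add, Matrix.trace_add, hV x hx, hW x hx]⟩
    | smul c Z _ hZ =>
      obtain ⟨W, hW⟩ := hZ
      exact ⟨c • W, fun x hx => by
        rw [mul_smul_comm, mul_smul_comm, Matrix.trace_smul, Matrix.trace_smul, hW x hx]⟩
  choose W hW using key
  refine ⟨{ toFun := fun X => Matrix.of fun i j => (X * W (Matrix.single j i 1)).trace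
            map_add' := fun X Y => by ext; simp [add_mul]
            map_smul' := fun c X => by ext; simp }, fun x hx => ?_⟩
  ext i j
  simp [← hW _ x hx, Matrix.trace_mul_single]

lemma MiddleLinear.succ [Fintype α] (hG : ∑ a, G a * A a = 1) {m : ℕ} (hspan : WordsSpan A m)
    (h : MiddleLinear A C k (m + 1)) : MiddleLinear A C k (m + 2) := by
  intro q p hq hp
  have hleft : ∀ a : α, ∃ Φ : Matrix (Fin D) (Fin D) ℂ →ₗ[ℂ] Matrix (Fin D) (Fin D) ℂ,
      ∀ x : List α, x.length = m + 1 →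
        openSum A C k (q ++ [a] ++ x ++ p) = Φ (wordProd A x) := by
    intro a
    obtain ⟨Φ, hΦ⟩ := h ((q ++ [a]).drop 1) p (by simp [hq]) hp
    refine ⟨LinearMap.mulLeft ℂ (wordProd A ((q ++ [a]).take 1)) ∘ₗ Φ
      + LinearMap.mulLeft ℂ (C (q ++ [a])) ∘ₗ LinearMap.mulRight ℂ (wordProd A p),
      fun x hx => ?_⟩
    rw [List.append_assoc (q ++ [a]), openSum_append_left (by simp [hq]), ← List.append_assoc,
      hΦ x hx]
    simp
  have hright : ∀ a : α, ∃ Ψ : Matrix (Fin D) (Fin D) ℂ →ₗ[ℂ] Matrix (Fin D) (Fin D) ℂ,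
      ∀ x : List α, x.length = m + 1 →
        openSum A C k (q ++ x ++ a :: p) = Ψ (wordProd A x) := by
    intro a
    obtain ⟨Ψ, hΨ⟩ := h q ((a :: p).take k) hq (by simp [hp])
    refine ⟨LinearMap.mulRight ℂ (wordProd A ((a :: p).drop k)) ∘ₗ Ψ
      + LinearMap.mulRight ℂ (C (a :: p)) ∘ₗ LinearMap.mulLeft ℂ (wordProd A q),
      fun x hx => ?_⟩
    rw [openSum_append_right (by simp [hp]), hΨ x hx]
    simp
  choose Φ hΦ using hleft
  choose Ψ hΨ using hright
  have hmid : ∀ a b : α, ∀ Y : Matrix (Fin D) (Fin D) ℂ, Φ a (Y * A b) = Ψ b (A a * Y) := by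
    intro a b Y
    refine LinearMap.congr_fun (hspan.eq_of_eqOn (f := Φ a ∘ₗ LinearMap.mulRight ℂ (A b))
      (g := Ψ b ∘ₗ LinearMap.mulLeft ℂ (A a)) fun y hy => ?_) Y
    have h1 := hΦ a (y ++ [b]) (by simp [hy])
    have h2 := hΨ b (a :: y) (by simp [hy])
    simp only [List.append_assoc, List.cons_append, List.nil_append, wordProd_append,
      wordProd_cons, wordProd_nil, mul_one] at h1 h2
    simp [← h1, ← h2]
  refine ⟨∑ b, Ψ b ∘ₗ LinearMap.mulRight ℂ (G b), fun x hx => ?_⟩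
  obtain ⟨a, y, rfl⟩ := List.exists_cons_of_length_eq_add_one hx
  have hy : y.length = m + 1 := by simpa using hx
  have h1 := hΦ a y hy
  have h2 : wordProd A y = ∑ b, (wordProd A y * G b) * A b := by
    simp_rw [mul_assoc, ← Finset.mul_sum, hG, mul_one]
  rw [h2, map_sum] at h1
  simp only [hmid] at h1
  simpa [mul_assoc] using h1

lemma exists_wordProd_ne_zero [NeZero D] {m : ℕ} (n : ℕ) (hspan : WordsSpan A (n + m)) :
    ∃ q : List α, q.length = n ∧ wordProd A q ≠ 0 := by
  obtain ⟨w, hw, hw0⟩ := hspan.exists_wordProd_apply_ne_zero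
    (f := (LinearMap.id : Matrix (Fin D) (Fin D) ℂ →ₗ[ℂ] Matrix (Fin D) (Fin D) ℂ))
    (fun h => one_ne_zero (LinearMap.congr_fun h 1))
  refine ⟨w.take n, by simp; omega, fun h => hw0 ?_⟩
  rw [LinearMap.id_apply, ← List.take_append_drop n w, wordProd_append, h, zero_mul]

lemma exists_telescopes_succ [NeZero D] {m₀ : ℕ} (hspan : ∀ m ≥ m₀, WordsSpan A m)
    (h : ∀ m ≥ m₀, MiddleLinear A C k m) :
    ∃ B : ℕ → List α → Matrix (Fin D) (Fin D) ℂ,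
      ∀ m ≥ m₀, WordTelescopes A C (B (m + 1)) (B m) k := by
  obtain ⟨q, hq, hq0⟩ := exists_wordProd_ne_zero k (hspan (k + m₀) (by omega))
  obtain ⟨a, b, hab⟩ : ∃ a b, wordProd A q a b ≠ 0 := by
    by_contra! h0
    exact hq0 (Matrix.ext h0)
  have hex : ∀ m : ℕ, ∀ p : List α,
      ∃ Φ : Matrix (Fin D) (Fin D) ℂ →ₗ[ℂ] Matrix (Fin D) (Fin D) ℂ, m₀ ≤ m → p.length = k →
        ∀ x : List α, x.length = m → openSum A C k (q ++ x ++ p) = Φ (wordProd A x) := by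
    intro m p
    by_cases hmp : m₀ ≤ m ∧ p.length = k
    · obtain ⟨Φ, hΦ⟩ := h m hmp.1 q p hq hmp.2
      exact ⟨Φ, fun _ _ => hΦ⟩
    · exact ⟨0, fun h1 h2 => absurd ⟨h1, h2⟩ hmp⟩
  choose Φ hΦ using hex
  refine ⟨fun m p => Matrix.of fun i j => (wordProd A q a b)⁻¹ * Φ m p (Matrix.single b i 1) a j,
    fun m hm u hu => ?_⟩
  obtain ⟨c, p, rfl⟩ := List.exists_cons_of_length_eq_add_one hu
  have hp : p.length = k := by simpa using hu
  have key : ∀ X : Matrix (Fin D) (Fin D) ℂ, Φ (m + 1) p (X * A c)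
      = Φ m ((c :: p).take k) X * wordProd A ((c :: p).drop k)
        + wordProd A q * X * C (c :: p) := by
    intro X
    refine LinearMap.congr_fun ((hspan m hm).eq_of_eqOn
      (f := Φ (m + 1) p ∘ₗ LinearMap.mulRight ℂ (A c))
      (g := LinearMap.mulRight ℂ (wordProd A ((c :: p).drop k)) ∘ₗ Φ m ((c :: p).take k)
        + LinearMap.mulRight ℂ (C (c :: p)) ∘ₗ LinearMap.mulLeft ℂ (wordProd A q))
      fun x hx => ?_) X
    have h1 := hΦ (m + 1) p (by omega) hp (x ++ [c]) (by simp [hx])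
    have h2 := hΦ m ((c :: p).take k) hm (by simp [hp]) x hx
    have h3 := openSum_append_right (A := A) (C := C) hu (q ++ x)
    rw [h2] at h3
    simp only [List.append_assoc, List.cons_append, List.nil_append, wordProd_append,
      wordProd_cons, wordProd_nil, mul_one] at h1 h3
    simp [← h1, h3]
  have hsingle : ∀ i, Matrix.single b i 1 * A c = ∑ j, A c i j • Matrix.single b j (1 : ℂ) := by
    intro i
    ext r s
    simp [Matrix.sum_apply, Matrix.single_apply, Matrix.mul_apply, ite_and]
  ext i l
  have hl := congr_fun (congr_fun (key (Matrix.single b i 1)) a) l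
  have hC : (wordProd A q * Matrix.single b i 1 * C (c :: p) : Matrix (Fin D) (Fin D) ℂ) a l
      = wordProd A q a b * C (c :: p) i l := by
    rw [mul_assoc, Matrix.mul_apply, Finset.sum_eq_single b] <;>
      simp +contextual [Matrix.single_mul_apply_of_ne]
  rw [hsingle, map_sum, Matrix.add_apply, hC] at hl
  simp only [map_smul, Matrix.sum_apply, Matrix.smul_apply, smul_eq_mul] at hl
  have hL : (A c * Matrix.of fun i j =>
      (wordProd A q a b)⁻¹ * Φ (m + 1) p (Matrix.single b i 1) a j) i l
      = (wordProd A q a b)⁻¹ * ∑ j, A c i j * Φ (m + 1) p (Matrix.single b j 1) a l := by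
    simp only [Matrix.mul_apply, Matrix.of_apply, Finset.mul_sum]
    exact Finset.sum_congr rfl fun j _ => by ring
  have hR : ((Matrix.of fun i j =>
      (wordProd A q a b)⁻¹ * Φ m ((c :: p).take k) (Matrix.single b i 1) a j)
        * wordProd A ((c :: p).drop k)) i l
      = (wordProd A q a b)⁻¹ * (Φ m ((c :: p).take k) (Matrix.single b i 1)
        * wordProd A ((c :: p).drop k)) a l := by
    simp only [Matrix.mul_apply, Matrix.of_apply, Finset.mul_sum]
    exact Finset.sum_congr rfl fun j _ => by ring
  simp only [List.take_succ_cons, List.take_zero, List.drop_succ_cons, List.drop_zero,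
    wordProd_cons, wordProd_nil, mul_one, Matrix.sub_apply]
  rw [hL, hR, hl]
  field_simp
  ring

lemma exists_telescopes_sub_smul [NeZero D] {m₀ : ℕ} (hspan : ∀ m ≥ m₀, WordsSpan A m)
    (h : ∀ m ≥ m₀, MiddleLinear A C k m) :
    ∃ (B : List α → Matrix (Fin D) (Fin D) ℂ) (c : ℂ),
      WordTelescopes A (fun u => C u - c • wordProd A u) B B k := by
  obtain ⟨B, hB⟩ := exists_telescopes_succ hspan h
  have hstep : ∀ m ≥ m₀, ∀ u : List α, u.length = k + 1 →
      wordProd A (u.take 1) * (B (m + 2) (u.drop 1) - B (m + 1) (u.drop 1))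
        = (B (m + 1) (u.take k) - B m (u.take k)) * wordProd A (u.drop k) := by
    intro m hm u hu
    have h1 := hB m hm u hu
    rw [hB (m + 1) (by omega) u hu, sub_eq_sub_iff_sub_eq_sub] at h1
    rw [mul_sub, sub_mul, h1]
  have hiter : ∀ s m, m₀ ≤ m → ∀ w : List α, w.length = s + k →
      wordProd A (w.take s) * (B (m + s + 1) (w.drop s) - B (m + s) (w.drop s))
        = (B (m + 1) (w.take k) - B m (w.take k)) * wordProd A (w.drop k) := by
    intro s
    induction s with
    | zero =>
      intro m _ w hw
      have hw : w.length = k := by simpa using hw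
      simp [← hw]
    | succ s ih =>
      intro m hm w hw
      obtain ⟨a, v, rfl⟩ := List.exists_cons_of_length_eq_add_one
        (show w.length = (s + k) + 1 by omega)
      have hv : v.length = s + k := by simp at hw; omega
      have h1 := ih (m + 1) (by omega) v hv
      have h2 := hstep m hm ((a :: v).take (k + 1)) (by simp; omega)
      have h3 : wordProd A ((a :: v).drop k)
          = wordProd A (((a :: v).take (k + 1)).drop k) * wordProd A (v.drop k) := by
        rw [← wordProd_append, show v.drop k = (a :: v).drop (k + 1) from rfl,
          ← List.drop_append_of_le_length (l₁ := (a :: v).take (k + 1)) (by simp; omega),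
          List.take_append_drop]
      rw [List.take_take, List.take_take, min_eq_left (by omega), min_eq_left (by omega)] at h2
      rw [h3, ← mul_assoc, ← h2]
      simp only [List.take_succ_cons, List.take_zero, List.drop_succ_cons, List.drop_zero,
        wordProd_cons, wordProd_nil, mul_one]
      rw [mul_assoc, mul_assoc, ← h1, show m + (s + 1) = m + 1 + s by ring]
  obtain ⟨q, hq, hq0⟩ := exists_wordProd_ne_zero k (hspan (k + m₀) (by omega))
  obtain ⟨a, b, hab⟩ : ∃ a b, wordProd A q a b ≠ 0 := by
    by_contra! h0
    exact hq0 (Matrix.ext h0)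
  obtain ⟨n, hn⟩ : ∃ n, n = m₀ + (k + m₀) := ⟨_, rfl⟩
  have hΔ : ∀ p : List α, p.length = k → B (n + 1) p - B n p
      = ((wordProd A q a b)⁻¹ * (B (m₀ + 1) q - B m₀ q) a b) • wordProd A p := by
    intro p hp
    have key : ∀ X : Matrix (Fin D) (Fin D) ℂ, wordProd A q * X * (B (n + 1) p - B n p)
        = (B (m₀ + 1) q - B m₀ q) * X * wordProd A p := by
      intro X
      refine LinearMap.congr_fun ((hspan m₀ le_rfl).eq_of_eqOn
        (f := LinearMap.mulRight ℂ (B (n + 1) p - B n p) ∘ₗ LinearMap.mulLeft ℂ (wordProd A q))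
        (g := LinearMap.mulRight ℂ (wordProd A p) ∘ₗ
          LinearMap.mulLeft ℂ (B (m₀ + 1) q - B m₀ q)) fun x hx => ?_) X
      have h1 := hiter (k + m₀) m₀ le_rfl ((q ++ x) ++ p) (by simp; omega)
      have hqx : (q ++ x).length = k + m₀ := by simp; omega
      rw [← hn, List.take_left' hqx, List.drop_left' hqx, List.append_assoc, List.take_left' hq,
        List.drop_left' hq, wordProd_append, wordProd_append, ← mul_assoc] at h1
      simpa using h1
    have hsingle : ∀ (M M' : Matrix (Fin D) (Fin D) ℂ) (i j : Fin D),
        (M * Matrix.single b i 1 * M' : Matrix (Fin D) (Fin D) ℂ) a j = M a b * M' i j := by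
      intro M M' i j
      rw [mul_assoc, Matrix.mul_apply, Finset.sum_eq_single b] <;>
        simp +contextual [Matrix.single_mul_apply_of_ne]
    ext i j
    have h1 := congr_fun (congr_fun (key (Matrix.single b i 1)) a) j
    rw [hsingle, hsingle] at h1
    rw [Matrix.smul_apply, smul_eq_mul, mul_assoc, ← h1, inv_mul_cancel_left₀ hab]
  refine ⟨B n, (wordProd A q a b)⁻¹ * (B (m₀ + 1) q - B m₀ q) a b, fun u hu => ?_⟩
  have h1 := hΔ (u.drop 1) (by simp [hu])
  rw [sub_eq_iff_eq_add] at h1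
  have h2 : wordProd A u = wordProd A (u.take 1) * wordProd A (u.drop 1) := by
    rw [← wordProd_append, List.take_append_drop]
  beta_reduce
  rw [hB n (by omega) u hu, h1, mul_add, mul_smul_comm, ← h2]
  abel

lemma wordProd_rotate_trace (A : α → Matrix (Fin D) (Fin D) ℂ) (w : List α) {n : ℕ}
    (hn : n ≤ w.length) : (wordProd A (w.rotate n)).trace = (wordProd A w).trace := by
  rw [List.rotate_eq_drop_append_take hn, wordProd_append, Matrix.trace_mul_comm,
    ← wordProd_append, List.take_append_drop]

lemma ringSum_sub_smul (c : ℂ) (w : List α) :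
    ringSum A (fun u => C u - c • wordProd A u) k w
      = ringSum A C k w - w.length * c * (wordProd A w).trace := by
  have h : ∀ n ∈ Finset.range w.length,
      headTrace A (fun u => C u - c • wordProd A u) k (w.rotate n)
        = headTrace A C k (w.rotate n) - c * (wordProd A w).trace := by
    intro n hn
    have hn : n ≤ w.length := by simp at hn; omega
    rw [headTrace, sub_mul, Matrix.trace_sub, smul_mul_assoc, ← wordProd_append,
      List.take_append_drop, Matrix.trace_smul, wordProd_rotate_trace A w hn, smul_eq_mul,
      headTrace]
  rw [ringSum, Finset.sum_congr rfl h, Finset.sum_sub_distrib, Finset.sum_const,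
    Finset.card_range, nsmul_eq_mul, mul_assoc, ringSum]

theorem ringSum_eq_zero_iff_exists_telescopes [Fintype α] [NeZero D]
    (hG : ∑ a, G a * A a = 1) {L N : ℕ} (hspan : WordsSpan A L) (hN : 2 * L + 2 * k + 1 ≤ N) :
    (∀ w : List α, w.length = N → ringSum A C k w = 0) ↔
      ∃ B : List α → Matrix (Fin D) (Fin D) ℂ, WordTelescopes A C B B k := by
  refine ⟨fun h => ?_, fun ⟨B, hB⟩ w hw => ringSum_eq_zero_of_telescopes hB (by omega)⟩
  obtain ⟨m, rfl⟩ : ∃ m, N = m + 1 + L + 2 * k := ⟨N - L - 2 * k - 1, by omega⟩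
  have hspan' : ∀ n ≥ L, WordsSpan A n := fun n hn => hspan.mono hG hn
  have hmid : ∀ n ≥ m + 1, MiddleLinear A C k n := by
    intro n hn
    induction n, hn using Nat.le_induction with
    | base => exact middleLinear_of_ringSum_eq_zero hspan h
    | succ n hn ih =>
      obtain ⟨n, rfl⟩ : ∃ n', n = n' + 1 := ⟨n - 1, by omega⟩
      exact ih.succ hG (hspan' n (by omega))
  obtain ⟨B, c, hB⟩ := exists_telescopes_sub_smul (fun n hn => hspan' n (by omega)) hmid
  obtain ⟨w, hw, hw0⟩ := (hspan' (m + 1 + L + 2 * k) (by omega)).exists_wordProd_apply_ne_zero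
    (f := Matrix.traceLinearMap (Fin D) ℂ ℂ)
    (fun h0 => by simpa [NeZero.ne D] using LinearMap.congr_fun h0 1)
  have h0 := ringSum_eq_zero_of_telescopes hB (w := w) (by omega)
  rw [ringSum_sub_smul, h w hw, zero_sub, neg_eq_zero] at h0
  have hw0 : (wordProd A w).trace ≠ 0 := hw0
  have hlen : (w.length : ℂ) ≠ 0 := by rw [hw]; exact_mod_cast (by omega)
  have hc : c = 0 := by simpa [hw0, hlen] using h0
  exact ⟨B, by simpa [hc] using hB⟩

end WordProducts

section Chain

variable {d D : ℕ}

lemma prodA_eq_wordProd {m : ℕ} (A : Fin d → Matrix (Fin D) (Fin D) ℂ) (i : Fin m → Fin d) :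
    prodA A i = wordProd A (List.ofFn i) := by
  rw [prodA, wordProd, List.map_ofFn]
  rfl

lemma InjectiveLen.wordsSpan {A : Fin d → Matrix (Fin D) (Fin D) ℂ} {L : ℕ}
    (h : InjectiveLen A L) : WordsSpan A L := by
  by_contra hne
  obtain ⟨f, hf0, hf⟩ := Submodule.exists_le_ker_of_lt_top _ (lt_top_iff_ne_top.2 hne)
  let X : Matrix (Fin D) (Fin D) ℂ := Matrix.of fun i j => f (Matrix.single j i 1)
  have hX : ∀ M, (X * M).trace = f M := by
    intro M
    conv_rhs => rw [Matrix.matrix_eq_sum_single M]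
    simp only [map_sum, Matrix.trace, Matrix.diag, Matrix.mul_apply, X, Matrix.of_apply]
    rw [Finset.sum_comm]
    refine Finset.sum_congr rfl fun i _ => Finset.sum_congr rfl fun j _ => ?_
    rw [← mul_one (M i j), ← smul_eq_mul (M i j), ← Matrix.smul_single, map_smul]
    simp [mul_comm]
  have hX0 : X = 0 := by
    refine h (funext fun i => ?_)
    change (X * prodA A i).trace = ((0 : Matrix (Fin D) (Fin D) ℂ) * prodA A i).trace
    rw [hX, zero_mul, Matrix.trace_zero]
    exact hf (Submodule.subset_span ⟨List.ofFn i, by simp, (prodA_eq_wordProd A i).symm⟩)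
  exact hf0 (LinearMap.ext fun M => by rw [← hX, hX0]; simp)

lemma TransferFixedPoints.exists_sum_mul_eq_one {A : Fin d → Matrix (Fin D) (Fin D) ℂ}
    {ρL ρR : Matrix (Fin D) (Fin D) ℂ} (h : TransferFixedPoints A ρL ρR) :
    ∃ G : Fin d → Matrix (Fin D) (Fin D) ℂ, ∑ a, G a * A a = 1 := by
  refine ⟨fun a => ρL⁻¹ * ((A a)ᴴ * ρL), ?_⟩
  simp_rw [mul_assoc ρL⁻¹, ← Finset.mul_sum]
  rw [h.2.2.1, Matrix.nonsing_inv_mul _ ((Matrix.isUnit_iff_isUnit_det _).1 h.1.isUnit)]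

/-- The configuration obtained from `x` by overwriting the `k` sites starting at `n` by `j`. -/
def overwrite {k N : ℕ} (x : Fin N → Fin d) (n : Fin N) (j : Fin k → Fin d) : Fin N → Fin d :=
  fun m => if h : (m.val + N - n.val) % N < k then j ⟨(m.val + N - n.val) % N, h⟩ else x m

lemma cyc_offset {N : ℕ} (n : Fin N) {t : ℕ} (ht : t < N) :
    ((cyc n t).val + N - n.val) % N = t := by
  have hn := n.isLt
  simp only [cyc]
  rcases lt_or_ge (n.val + t) N with h | h
  · rw [Nat.mod_eq_of_lt h, show n.val + t + N - n.val = t + N by omega, Nat.add_mod_right,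
      Nat.mod_eq_of_lt ht]
  · rw [Nat.mod_eq_sub_mod h, Nat.mod_eq_of_lt (by omega : n.val + t - N < N),
      show n.val + t - N + N - n.val = t by omega, Nat.mod_eq_of_lt ht]

lemma cyc_offset_eq {N : ℕ} (n m : Fin N) : cyc n ((m.val + N - n.val) % N) = m := by
  have hn := n.isLt
  have hm := m.isLt
  ext
  simp only [cyc, Nat.add_mod_mod]
  rw [show n.val + (m.val + N - n.val) = m.val + N by omega, Nat.add_mod_right,
    Nat.mod_eq_of_lt hm]

lemma overwrite_cyc {k N : ℕ} (x : Fin N → Fin d) (n : Fin N) (j : Fin k → Fin d)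
    {t : ℕ} (ht : t < N) :
    overwrite x n j (cyc n t) = if h : t < k then j ⟨t, h⟩ else x (cyc n t) := by
  simp only [overwrite, cyc_offset n ht]

lemma ofFn_rotate {N : ℕ} (x : Fin N → Fin d) (n : Fin N) :
    (List.ofFn x).rotate n = List.ofFn fun t : Fin N => x (cyc n t) := by
  refine List.ext_getElem (by simp) fun t h1 h2 => ?_
  simp [List.getElem_rotate, cyc, add_comm]

lemma ofFn_overwrite_rotate {k N : ℕ} (hk : k ≤ N) (x : Fin N → Fin d) (n : Fin N)
    (j : Fin k → Fin d) :
    (List.ofFn (overwrite x n j)).rotate n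
      = List.ofFn j ++ ((List.ofFn x).rotate n).drop k := by
  rw [ofFn_rotate, ofFn_rotate]
  refine List.ext_getElem (by simp; omega) fun t h1 h2 => ?_
  have ht : t < N := by simpa using h1
  rw [List.getElem_append]
  simp only [List.getElem_ofFn, overwrite_cyc x n j ht, List.length_ofFn, List.getElem_drop]
  split_ifs with h
  · rfl
  · congr 3
    omega

lemma localOp_mulVec_apply {k N : ℕ} (hk : k ≤ N) (o : Matrix (Fin k → Fin d) (Fin k → Fin d) ℂ)
    (n : Fin N) (ψ : (Fin N → Fin d) → ℂ) (x : Fin N → Fin d) :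
    (localOp o n).mulVec ψ x
      = ∑ j, o (fun t => x (cyc n t.val)) j * ψ (overwrite x n j) := by
  have hwin : ∀ (j : Fin k → Fin d) (t : Fin k), overwrite x n j (cyc n t.val) = j t := by
    intro j t
    rw [overwrite_cyc x n j (by omega), dif_pos t.isLt]
  rw [Matrix.mulVec, dotProduct]
  refine (Fintype.sum_of_injective (overwrite x n) ?_ _ _ ?_ ?_).symm
  · intro j j' h
    funext t
    rw [← hwin j t, h, hwin]
  · intro y hy
    rw [localOp, Matrix.of_apply, if_neg, mul_zero, zero_mul]
    intro hagree
    refine hy ⟨fun t => y (cyc n t.val), funext fun m => ?_⟩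
    simp only [overwrite]
    split_ifs with h
    · rw [cyc_offset_eq]
    · refine hagree m fun t hm => h ?_
      rw [hm, cyc_offset n (by omega)]
      exact t.isLt
  · intro j
    rw [localOp, Matrix.of_apply, if_pos, mul_one]
    · simp only [hwin]
    · intro m hm
      rw [overwrite, dif_neg]
      exact fun h => hm ⟨_, h⟩ (cyc_offset_eq n m).symm

/-- The family `o A ⋯ A - ε A ⋯ A`, indexed by words; `a` is a padding letter. -/
noncomputable def localDefect {k : ℕ} (A : Fin d → Matrix (Fin D) (Fin D) ℂ)
    (o : Matrix (Fin k → Fin d) (Fin k → Fin d) ℂ) (ε : ℂ) (a : Fin d) (w : List (Fin d)) :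
    Matrix (Fin D) (Fin D) ℂ :=
  (∑ j : Fin k → Fin d, o (fun t => w.getD t a) j • prodA A j)
    - ε • prodA A (fun t : Fin k => w.getD t a)

lemma localDefect_ofFn {k : ℕ} (A : Fin d → Matrix (Fin D) (Fin D) ℂ)
    (o : Matrix (Fin k → Fin d) (Fin k → Fin d) ℂ) (ε : ℂ) (a : Fin d) (i : Fin k → Fin d) :
    localDefect A o ε a (List.ofFn i)
      = (∑ j : Fin k → Fin d, o i j • prodA A j) - ε • prodA A i := by
  simp [localDefect]

lemma headTrace_localDefect {k N : ℕ} (hk : k + 1 ≤ N) (A : Fin d → Matrix (Fin D) (Fin D) ℂ)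
    (o : Matrix (Fin (k + 1) → Fin d) (Fin (k + 1) → Fin d) ℂ) (ε : ℂ) (a : Fin d)
    (x : Fin N → Fin d) (n : Fin N) :
    headTrace A (localDefect A o ε a) k ((List.ofFn x).rotate n)
      = (localOp o n).mulVec (mps A N) x - ε * mps A N x := by
  have hmps : ∀ y : Fin N → Fin d,
      mps A N y = (wordProd A ((List.ofFn y).rotate n)).trace := fun y => by
    rw [wordProd_rotate_trace _ _ (by simp), mps, prodA_eq_wordProd]
  have htake : ((List.ofFn x).rotate n).take (k + 1)
      = List.ofFn fun t : Fin (k + 1) => x (cyc n t) := by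
    rw [ofFn_rotate]
    refine List.ext_getElem (by simpa using hk) fun t h1 h2 => ?_
    simp only [List.getElem_take, List.getElem_ofFn]
  have hsplit : wordProd A ((List.ofFn x).rotate n)
      = wordProd A (List.ofFn fun t : Fin (k + 1) => x (cyc n t))
        * wordProd A (((List.ofFn x).rotate n).drop (k + 1)) := by
    rw [← htake, ← wordProd_append, List.take_append_drop]
  rw [headTrace, htake, localDefect_ofFn, localOp_mulVec_apply hk, hmps x, hsplit, sub_mul,
    Matrix.trace_sub, smul_mul_assoc, Matrix.trace_smul, smul_eq_mul, prodA_eq_wordProd,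
    Finset.sum_mul, Matrix.trace_sum]
  congr 1
  refine Finset.sum_congr rfl fun j _ => ?_
  rw [hmps, ofFn_overwrite_rotate hk, wordProd_append, smul_mul_assoc, Matrix.trace_smul,
    smul_eq_mul, prodA_eq_wordProd]

lemma ringSum_localDefect {k N : ℕ} (hk : k + 1 ≤ N) (A : Fin d → Matrix (Fin D) (Fin D) ℂ)
    (o : Matrix (Fin (k + 1) → Fin d) (Fin (k + 1) → Fin d) ℂ) (ε : ℂ) (a : Fin d)
    (x : Fin N → Fin d) :
    ringSum A (localDefect A o ε a) k (List.ofFn x)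
      = (opSum (N := N) o).mulVec (mps A N) x - N * ε * mps A N x := by
  rw [ringSum, List.length_ofFn,
    ← Fin.sum_univ_eq_sum_range fun n =>
      headTrace A (localDefect A o ε a) k ((List.ofFn x).rotate n)]
  simp_rw [headTrace_localDefect hk]
  rw [Finset.sum_sub_distrib, opSum, Matrix.sum_mulVec, Finset.sum_apply]
  simp [mul_assoc]

lemma exists_telescopes_iff {k : ℕ} (A : Fin d → Matrix (Fin D) (Fin D) ℂ)
    (o : Matrix (Fin (k + 1) → Fin d) (Fin (k + 1) → Fin d) ℂ) (ε : ℂ) (a : Fin d) :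
    (∃ B : List (Fin d) → Matrix (Fin D) (Fin D) ℂ,
        WordTelescopes A (localDefect A o ε a) B B k) ↔
      ∃ B : (Fin k → Fin d) → Matrix (Fin D) (Fin D) ℂ, Telescopes A o ε B := by
  have hhead : ∀ i : Fin (k + 1) → Fin d, (List.ofFn i).take 1 = [i 0] := by
    intro i; simp [List.ofFn_succ]
  have htail : ∀ i : Fin (k + 1) → Fin d,
      (List.ofFn i).drop 1 = List.ofFn fun t => i t.succ := by
    intro i; simp [List.ofFn_succ]
  have hfront : ∀ i : Fin (k + 1) → Fin d,
      (List.ofFn i).take k = List.ofFn fun t => i t.castSucc := by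
    intro i; rw [List.ofFn_succ', List.concat_eq_append, List.take_left' (by simp)]
  have hlast : ∀ i : Fin (k + 1) → Fin d, (List.ofFn i).drop k = [i (Fin.last k)] := by
    intro i; rw [List.ofFn_succ', List.concat_eq_append, List.drop_left' (by simp)]
  constructor
  · rintro ⟨B, hB⟩
    refine ⟨fun i => B (List.ofFn i), fun i => ?_⟩
    have h := hB (List.ofFn i) (by simp)
    rw [localDefect_ofFn, hhead, htail, hfront, hlast] at h
    simpa using h
  · rintro ⟨B, hB⟩
    refine ⟨fun w => B fun t => w.getD t a, fun u hu => ?_⟩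
    obtain ⟨i, rfl⟩ : ∃ i : Fin (k + 1) → Fin d, u = List.ofFn i :=
      ⟨fun t => u[t], by simp [← hu]⟩
    rw [localDefect_ofFn, hhead, htail, hfront, hlast, hB i]
    simp

end Chain

/-- For an injective MPS tensor with positive definite transfer
fixed points, and `N > 2L + 2k − 1` (here the number of sites of `o` is `k+1 ≥ 1`),
the MPS is an eigenstate of `O_N` with eigenvalue `N ε` iff the local telescoping
equation for `(A, o, ε)` has a solution `B`. -/
theorem mps_eigenstate_iff_telescopes
    (d D : ℕ) (hd : 1 ≤ d) (hD : 1 ≤ D)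
    (A : Fin d → Matrix (Fin D) (Fin D) ℂ)
    (L : ℕ) (hinj : InjectiveLen A L)
    (ρL ρR : Matrix (Fin D) (Fin D) ℂ) (hfix : TransferFixedPoints A ρL ρR)
    (k : ℕ) (o : Matrix (Fin (k+1) → Fin d) (Fin (k+1) → Fin d) ℂ)
    (ε : ℂ) (N : ℕ) (hN : 2 * L + 2 * k + 1 < N) :
    (opSum (N := N) o).mulVec (mps A N) = ((N : ℂ) * ε) • mps A N
      ↔ ∃ B : (Fin k → Fin d) → Matrix (Fin D) (Fin D) ℂ, Telescopes A o ε B := by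
  have : NeZero D := ⟨by omega⟩
  obtain ⟨G, hG⟩ := hfix.exists_sum_mul_eq_one
  rw [← exists_telescopes_iff A o ε ⟨0, hd⟩,
    ← ringSum_eq_zero_iff_exists_telescopes hG hinj.wordsSpan hN.le, funext_iff]
  constructor
  · rintro h w rfl
    have hx := h w.get
    rw [← List.ofFn_get w, ringSum_localDefect (by omega)]
    simpa [sub_eq_zero] using hx
  · intro h x
    have hx := h (List.ofFn x) (by simp)
    rw [ringSum_localDefect (by omega)] at hx
    simpa [sub_eq_zero] using hx
end

section
/- Let A be an MPS tensor that is injective with injectivity length L and admits positive definite transfer fixed points ρ_L, ρ_R. Let o be a k-site operator (k ≥ 1), let N > 2L + 2k − 1, and suppose O_N ψ_N = E_N ψ_N for some E_N ∈ ℂ. Then, setting ε := E_N / N, there exists a family B = (B^{i_1…i_{k−1}}) of D×D complex matrices satisfying the local telescoping equation for (A, o, ε). -/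
open Matrix
open scoped ComplexOrder

namespace MPS

section Words

variable {ι n : Type*} [Fintype n] [DecidableEq n]

/-- The product of the matrices `A a` along the letters `a` of a list. -/
noncomputable def word (A : ι → Matrix n n ℂ) (l : List ι) : Matrix n n ℂ :=
  (l.map A).prod

@[simp] lemma word_nil (A : ι → Matrix n n ℂ) : word A [] = 1 := by simp [word]

@[simp] lemma word_cons (A : ι → Matrix n n ℂ) (a : ι) (l : List ι) :
    word A (a :: l) = A a * word A l := by simp [word]

@[simp] lemma word_append (A : ι → Matrix n n ℂ) (l l' : List ι) :
    word A (l ++ l') = word A l * word A l' := by simp [word]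

lemma trace_word_rotate (A : ι → Matrix n n ℂ) (x : List ι) (s : ℕ) :
    (word A (x.rotate s)).trace = (word A x).trace := by
  rw [List.rotate_eq_drop_append_take_mod, word_append, Matrix.trace_mul_comm, ← word_append,
    List.take_append_drop]

/-- The block `F` placed on the first `k + 1` letters, followed by the word of the others. -/
noncomputable def headTerm (A : ι → Matrix n n ℂ) (F : List ι → Matrix n n ℂ) (k : ℕ)
    (l : List ι) : Matrix n n ℂ :=
  F (l.take (k + 1)) * word A (l.drop (k + 1))

/-- The sum over all placements of the block `F` on `k + 1` consecutive letters of a list. -/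
noncomputable def openSum (A : ι → Matrix n n ℂ) (F : List ι → Matrix n n ℂ) (k : ℕ)
    (l : List ι) : Matrix n n ℂ :=
  ∑ s ∈ Finset.range (l.length - k), word A (l.take s) * headTerm A F k (l.drop s)

variable (A : ι → Matrix n n ℂ) (F : List ι → Matrix n n ℂ) {k : ℕ}

lemma headTerm_append {l : List ι} (hl : k + 1 ≤ l.length) (l' : List ι) :
    headTerm A F k (l ++ l') = headTerm A F k l * word A l' := by
  simp [headTerm, List.take_append_of_le_length hl, List.drop_append_of_le_length hl, mul_assoc]

lemma openSum_cons (a : ι) {l : List ι} (hl : k ≤ l.length) :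
    openSum A F k (a :: l) = A a * openSum A F k l + headTerm A F k (a :: l) := by
  have h : (a :: l).length - k = l.length - k + 1 := by simp; omega
  rw [openSum, h, Finset.sum_range_succ']
  simp [openSum, Finset.mul_sum, mul_assoc]

lemma openSum_concat {p q : List ι} {b : ι} (hq : q.length = k) :
    openSum A F k (p ++ q ++ [b]) = openSum A F k (p ++ q) * A b + word A p * F (q ++ [b]) := by
  have h : (p ++ q ++ [b]).length - k = (p ++ q).length - k + 1 := by simp; omega
  rw [openSum, h, Finset.sum_range_succ]
  congr 1
  · rw [openSum, Finset.sum_mul]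
    refine Finset.sum_congr rfl fun s hs => ?_
    simp only [Finset.mem_range, List.length_append] at hs
    rw [List.take_append_of_le_length (by simp; omega),
      List.drop_append_of_le_length (by simp; omega),
      headTerm_append A F (by simp; omega), mul_assoc]
    simp
  · have h2 : (p ++ q).length - k = p.length := by simp; omega
    rw [h2, List.append_assoc, List.take_left, List.drop_left, headTerm]
    subst hq
    simp [List.take_of_length_le]

lemma trace_openSum_mul (y z : List ι) :
    (openSum A F k y * word A z).trace
      = ∑ s ∈ Finset.range (y.length - k), (headTerm A F k ((y ++ z).rotate s)).trace := by
  rw [openSum, Finset.sum_mul, Matrix.trace_sum]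
  refine Finset.sum_congr rfl fun s hs => ?_
  simp only [Finset.mem_range] at hs
  rw [List.rotate_eq_drop_append_take (by simp; omega),
    List.take_append_of_le_length (by omega), List.drop_append_of_le_length (by omega),
    headTerm_append A F (by simp; omega), headTerm_append A F (by simp; omega), mul_assoc,
    Matrix.trace_mul_comm, mul_assoc]

/-- Splitting a vanishing cyclic sum into the placements meeting one of two opposite arcs. -/
lemma trace_openSum_add_trace_openSum {N : ℕ}
    (hcyc : ∀ x : List ι, x.length = N →
      ∑ s ∈ Finset.range N, (headTerm A F k (x.rotate s)).trace = 0)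
    {p q u w : List ι} (hp : p.length = k) (hq : q.length = k)
    (hN : q.length + u.length + p.length + w.length = N) :
    (openSum A F k (q ++ u ++ p) * word A w).trace
      + (word A u * openSum A F k (p ++ w ++ q)).trace = 0 := by
  rw [Matrix.trace_mul_comm (word A u), trace_openSum_mul, trace_openSum_mul]
  rw [← hcyc (q ++ u ++ p ++ w) (by simp; omega)]
  have h1 : N = ((q ++ u ++ p).length - k) + ((p ++ w ++ q).length - k) := by simp; omega
  rw [h1, Finset.sum_range_add]
  congr 1
  refine Finset.sum_congr rfl fun s _ => ?_
  rw [← List.rotate_rotate]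
  congr 3
  have h2 : (q ++ u ++ p).length - k = (q ++ u).length := by simp; omega
  rw [h2, List.append_assoc (q ++ u), List.rotate_append_length_eq]
  simp

end Words

section Contract

variable {n : Type*} [Fintype n] [DecidableEq n]

/-- The contraction sending `X ↦ P * X * Q` to `(Q * Z).trace • P`. -/
noncomputable def contract (G : Matrix n n ℂ →ₗ[ℂ] Matrix n n ℂ) (Z : Matrix n n ℂ) :
    Matrix n n ℂ :=
  ∑ i, ∑ j, G (single i j 1) * Z * single j i 1

lemma contract_add (G H : Matrix n n ℂ →ₗ[ℂ] Matrix n n ℂ) (Z : Matrix n n ℂ) :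
    contract (G + H) Z = contract G Z + contract H Z := by
  simp [contract, add_mul, Finset.sum_add_distrib]

lemma contract_sum {κ : Type*} (s : Finset κ) (G : Matrix n n ℂ →ₗ[ℂ] Matrix n n ℂ)
    (Z : κ → Matrix n n ℂ) : contract G (∑ a ∈ s, Z a) = ∑ a ∈ s, contract G (Z a) := by
  simp only [contract, Finset.mul_sum, Finset.sum_mul]
  simp_rw [Finset.sum_comm (s := s)]

lemma contract_mulLeft_comp (P : Matrix n n ℂ) (G : Matrix n n ℂ →ₗ[ℂ] Matrix n n ℂ)
    (Z : Matrix n n ℂ) : contract (LinearMap.mulLeft ℂ P ∘ₗ G) Z = P * contract G Z := by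
  simp [contract, Finset.mul_sum, mul_assoc]

lemma contract_mulRight_comp (Q : Matrix n n ℂ) (G : Matrix n n ℂ →ₗ[ℂ] Matrix n n ℂ)
    (Z : Matrix n n ℂ) : contract (LinearMap.mulRight ℂ Q ∘ₗ G) Z = contract G (Q * Z) := by
  simp [contract, mul_assoc]

lemma mul_single_eq_sum (M : Matrix n n ℂ) (i j : n) :
    M * single i j 1 = ∑ l, M l i • single l j (1 : ℂ) := by
  ext a b
  simp only [mul_apply, single_apply, Matrix.sum_apply, Matrix.smul_apply, smul_eq_mul]
  by_cases h : j = b <;> simp [h]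

lemma single_mul_eq_sum (M : Matrix n n ℂ) (i j : n) :
    single i j 1 * M = ∑ l, M j l • single i l (1 : ℂ) := by
  ext a b
  simp only [mul_apply, single_apply, Matrix.sum_apply, Matrix.smul_apply, smul_eq_mul]
  by_cases h : i = a <;> simp [h]

lemma contract_comp_mulLeft (G : Matrix n n ℂ →ₗ[ℂ] Matrix n n ℂ) (M Z : Matrix n n ℂ) :
    contract (G ∘ₗ LinearMap.mulLeft ℂ M) Z = contract G Z * M := by
  simp only [contract, LinearMap.comp_apply, LinearMap.mulLeft_apply, mul_single_eq_sum M,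
    single_mul_eq_sum M, map_sum, map_smul, Finset.sum_mul, smul_mul_assoc, mul_assoc,
    Finset.mul_sum, mul_smul_comm]
  rw [Finset.sum_comm]
  conv_rhs => rw [Finset.sum_comm]
  refine (Finset.sum_congr rfl fun j _ => Finset.sum_comm).trans ?_
  rw [Finset.sum_comm]

lemma contract_comp_mulRight (G : Matrix n n ℂ →ₗ[ℂ] Matrix n n ℂ) (M Z : Matrix n n ℂ) :
    contract (G ∘ₗ LinearMap.mulRight ℂ M) Z = contract G (Z * M) := by
  simp only [contract, LinearMap.comp_apply, LinearMap.mulRight_apply, mul_single_eq_sum M,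
    single_mul_eq_sum M, map_sum, map_smul, Finset.sum_mul, smul_mul_assoc, mul_assoc,
    Finset.mul_sum, mul_smul_comm]
  refine Finset.sum_congr rfl fun i _ => ?_
  rw [Finset.sum_comm]

lemma contract_id (Z : Matrix n n ℂ) : contract LinearMap.id Z = Z.trace • 1 := by
  ext a b
  simp only [contract, LinearMap.id_apply, Matrix.sum_apply, single_mul_mul_single, one_mul,
    mul_one, single_apply, Matrix.smul_apply, one_apply, smul_eq_mul, Matrix.trace, diag_apply]
  by_cases h : a = b
  · subst h; simp
  · simp only [h, if_false, mul_zero]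
    refine Finset.sum_eq_zero fun i _ => Finset.sum_eq_zero fun j _ => if_neg ?_
    rintro ⟨rfl, rfl⟩; exact h rfl

end Contract

section Linear

variable {n : Type*} [Fintype n] [DecidableEq n]

lemma span_range_eq_top_of_trace {κ : Type*} {v : κ → Matrix n n ℂ}
    (hv : ∀ X : Matrix n n ℂ, (∀ i, (X * v i).trace = 0) → X = 0) :
    Submodule.span ℂ (Set.range v) = ⊤ := by
  by_contra hne
  obtain ⟨f, hf0, hf⟩ := Submodule.exists_le_ker_of_lt_top _ (lt_top_iff_ne_top.mpr hne)
  let X : Matrix n n ℂ := Matrix.of fun j i => f (single i j 1)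
  have hX : ∀ M, f M = (X * M).trace := by
    intro M
    conv_lhs => rw [matrix_eq_sum_single M]
    simp only [map_sum, Matrix.trace, diag_apply, mul_apply]
    rw [Finset.sum_comm]
    refine Finset.sum_congr rfl fun j _ => Finset.sum_congr rfl fun i _ => ?_
    have : single i j (M i j) = M i j • single i j (1 : ℂ) := by simp
    rw [this, map_smul, smul_eq_mul, mul_comm]
    rfl
  refine hf0 (LinearMap.ext fun M => ?_)
  rw [hX, hv X fun i => ?_]
  · simp
  · rw [← hX]
    exact hf (Submodule.subset_span ⟨i, rfl⟩)

/-- A family `s` which is trace-dual to `v` factors linearly through `v`. -/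
lemma exists_linearMap_of_trace {κ κ' : Type*} {v s : κ → Matrix n n ℂ}
    {w t : κ' → Matrix n n ℂ} (hv : Submodule.span ℂ (Set.range v) = ⊤)
    (hw : ∀ X : Matrix n n ℂ, (∀ i, (X * w i).trace = 0) → X = 0)
    (h : ∀ i j, (s i * w j).trace + (v i * t j).trace = 0) :
    ∃ G : Matrix n n ℂ →ₗ[ℂ] Matrix n n ℂ, ∀ i, G (v i) = s i := by
  have hsurj : LinearMap.range (Finsupp.linearCombination ℂ v) = ⊤ := by
    rw [Finsupp.range_linearCombination, hv]
  obtain ⟨g, hg⟩ := LinearMap.exists_rightInverse_of_surjective _ hsurj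
  refine ⟨Finsupp.linearCombination ℂ s ∘ₗ g, fun i => ?_⟩
  have key : ∀ c, Finsupp.linearCombination ℂ v c = 0 → Finsupp.linearCombination ℂ s c = 0 := by
    intro c hc
    refine hw _ fun j => ?_
    have h2 : Matrix.traceLinearMap n ℂ ℂ ∘ₗ LinearMap.mulRight ℂ (w j) ∘ₗ
        Finsupp.linearCombination ℂ s
        + Matrix.traceLinearMap n ℂ ℂ ∘ₗ LinearMap.mulRight ℂ (t j) ∘ₗ
          Finsupp.linearCombination ℂ v = 0 := by
      refine Finsupp.lhom_ext' fun i => LinearMap.ext_ring ?_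
      simpa using h i j
    simpa [hc] using LinearMap.congr_fun h2 c
  have h3 := key (g (v i) - Finsupp.single i 1) (by
    have := LinearMap.congr_fun hg (v i)
    simp only [LinearMap.comp_apply, LinearMap.id_apply] at this
    simp [this])
  simpa [sub_eq_zero] using h3

open scoped MatrixOrder Matrix.Norms.L2Operator in
lemma trace_mul_ne_zero_of_posDef [Nonempty n] {P Q : Matrix n n ℂ} (hP : P.PosDef)
    (hQ : Q.PosDef) : (P * Q).trace ≠ 0 := by
  obtain ⟨B, rfl⟩ := CStarAlgebra.nonneg_iff_eq_star_mul_self.mp hP.posSemidef.nonneg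
  have hu : IsUnit B := isUnit_of_mul_isUnit_right hP.isUnit
  rw [mul_assoc, Matrix.trace_mul_comm]
  exact (hQ.mul_mul_conjTranspose_same (Matrix.vecMul_injective_of_isUnit hu)).trace_pos.ne'

end Linear

section Extension

variable {ι n : Type*} [Fintype n] [DecidableEq n] {A : ι → Matrix n n ℂ}

/-- The words of length `m` separate matrices under the trace pairing. -/
def Separates (A : ι → Matrix n n ℂ) (m : ℕ) : Prop :=
  ∀ X : Matrix n n ℂ, (∀ w : {l : List ι // l.length = m}, (X * word A w).trace = 0) → X = 0

lemma Separates.of_le [Fintype ι] {R : Matrix n n ℂ} (hR : IsUnit R)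
    (hfix : ∑ a, A a * R * (A a)ᴴ = R) {L m : ℕ} (hL : Separates A L) (hm : L ≤ m) :
    Separates A m := by
  induction m, hm using Nat.le_induction with
  | base => exact hL
  | succ m _ ih =>
    intro X hX
    have h0 : ∀ a, X * A a = 0 := fun a => ih _ fun w => by
      simpa [mul_assoc] using hX ⟨a :: w, by simp [w.2]⟩
    refine hR.mul_left_eq_zero.mp ?_
    rw [← hfix, Finset.mul_sum]
    refine Finset.sum_eq_zero fun a _ => ?_
    rw [← mul_assoc, ← mul_assoc, h0, zero_mul, zero_mul]

lemma Separates.linearMap_ext {m : ℕ} (hm : Separates A m)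
    {G H : Matrix n n ℂ →ₗ[ℂ] Matrix n n ℂ}
    (h : ∀ l : List ι, l.length = m → G (word A l) = H (word A l)) : G = H := by
  refine LinearMap.ext_on (span_range_eq_top_of_trace hm) ?_
  rintro _ ⟨l, rfl⟩
  exact h l l.2

lemma exists_linearMap_openSum {F : List ι → Matrix n n ℂ} {k N m r : ℕ}
    (hcyc : ∀ x : List ι, x.length = N →
      ∑ s ∈ Finset.range N, (headTerm A F k (x.rotate s)).trace = 0)
    (hm : Separates A m) (hr : Separates A r) (hN : 2 * k + m + r = N) (p q : List ι) :
    ∃ G : Matrix n n ℂ →ₗ[ℂ] Matrix n n ℂ, p.length = k → q.length = k →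
      ∀ u : List ι, u.length = m → G (word A u) = openSum A F k (q ++ u ++ p) := by
  by_cases hpq : p.length = k ∧ q.length = k
  · obtain ⟨G, hG⟩ := exists_linearMap_of_trace
      (v := fun u : {l : List ι // l.length = m} => word A u)
      (s := fun u => openSum A F k (q ++ u ++ p))
      (w := fun w : {l : List ι // l.length = r} => word A w)
      (t := fun w => openSum A F k (p ++ w ++ q))
      (span_range_eq_top_of_trace hm) hr fun u w =>
        trace_openSum_add_trace_openSum A F hcyc hpq.1 hpq.2 (by
          rw [u.2, w.2]; omega)
    exact ⟨G, fun _ _ u hu => hG ⟨u, hu⟩⟩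
  · exact ⟨0, fun hp hq => absurd ⟨hp, hq⟩ hpq⟩

end Extension

section OfFn

variable {ι : Type*}

lemma ofFn_snoc {k : ℕ} (q : Fin k → ι) (a : ι) :
    List.ofFn (Fin.snoc q a : Fin (k + 1) → ι) = List.ofFn q ++ [a] := by
  simp [List.ofFn_succ', -List.ofFn_succ]

lemma ofFn_eq_cons {k : ℕ} (l : Fin (k + 1) → ι) :
    List.ofFn l = l 0 :: List.ofFn fun t : Fin k => l t.succ := List.ofFn_succ

lemma ofFn_eq_concat {k : ℕ} (l : Fin (k + 1) → ι) :
    List.ofFn l = (List.ofFn fun t : Fin k => l t.castSucc) ++ [l (Fin.last k)] := by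
  simp [List.ofFn_succ', -List.ofFn_succ]

end OfFn

section FixedPoint

variable {ι n : Type*} [Fintype ι] [Fintype n] [DecidableEq n] {A : ι → Matrix n n ℂ}

lemma sum_fin_succ_eq_sum_cons {M : Type*} [AddCommMonoid M] {k : ℕ}
    (f : (Fin (k + 1) → ι) → M) :
    ∑ l, f l = ∑ q : Fin k → ι, ∑ a, f (Fin.cons a q : Fin (k + 1) → ι) := by
  rw [← (Fin.consEquiv fun _ => ι).sum_comp, Fintype.sum_prod_type, Finset.sum_comm]
  rfl

lemma sum_fin_succ_eq_sum_snoc {M : Type*} [AddCommMonoid M] {k : ℕ}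
    (f : (Fin (k + 1) → ι) → M) :
    ∑ l, f l = ∑ q : Fin k → ι, ∑ a, f (Fin.snoc q a : Fin (k + 1) → ι) := by
  rw [← (Fin.snocEquiv fun _ => ι).sum_comp, Fintype.sum_prod_type, Finset.sum_comm]
  rfl

lemma sum_word_mul_mul_conjTranspose {R : Matrix n n ℂ}
    (hR : ∑ a, A a * R * (A a)ᴴ = R) (k : ℕ) :
    ∑ p : Fin k → ι, word A (List.ofFn p) * R * (word A (List.ofFn p))ᴴ = R := by
  induction k with
  | zero => simp
  | succ k ih =>
    rw [sum_fin_succ_eq_sum_snoc]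
    conv_rhs => rw [← ih]
    refine Finset.sum_congr rfl fun p _ => ?_
    conv_rhs => rw [← hR]
    simp [ofFn_snoc, -List.ofFn_succ, Finset.mul_sum, Finset.sum_mul, mul_assoc]

/-- The weight of a word, dual to it under the pairing given by the two fixed points. -/
noncomputable def weight (A : ι → Matrix n n ℂ) (P R : Matrix n n ℂ) (l : List ι) :
    Matrix n n ℂ :=
  R * (word A l)ᴴ * P

lemma sum_weight_cons_mul {P R : Matrix n n ℂ} (hP : ∑ a, (A a)ᴴ * P * A a = P) (l : List ι) :
    ∑ a, weight A P R (a :: l) * A a = weight A P R l := by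
  conv_rhs => rw [weight, ← hP]
  simp [weight, Finset.mul_sum, mul_assoc]

lemma sum_mul_weight_concat {P R : Matrix n n ℂ} (hR : ∑ a, A a * R * (A a)ᴴ = R)
    (l : List ι) : ∑ a, A a * weight A P R (l ++ [a]) = weight A P R l := by
  conv_rhs => rw [weight, ← hR]
  simp [weight, Finset.sum_mul, mul_assoc]

lemma sum_trace_word_mul_weight {P R : Matrix n n ℂ} (hR : ∑ a, A a * R * (A a)ᴴ = R) (k : ℕ) :
    ∑ p : Fin k → ι, (word A (List.ofFn p) * weight A P R (List.ofFn p)).trace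
      = (R * P).trace := by
  conv_rhs => rw [← sum_word_mul_mul_conjTranspose hR k]
  simp [weight, Finset.sum_mul, Matrix.trace_sum, mul_assoc]

end FixedPoint

section Telescoping

variable {ι n : Type*} [Fintype n] [DecidableEq n] {A : ι → Matrix n n ℂ}
  {F : List ι → Matrix n n ℂ} {k : ℕ}

/-- A block whose open sums factor linearly through the words of two consecutive lengths is a
telescoping difference, up to a multiple of the word itself. -/
lemma exists_telescoping_add_smul [Fintype ι] [Nonempty n] {P R : Matrix n n ℂ} (hP : P.PosDef)
    (hR : R.PosDef) (hPfix : ∑ a, (A a)ᴴ * P * A a = P) (hRfix : ∑ a, A a * R * (A a)ᴴ = R)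
    {m : ℕ} (hm : Separates A m) {G G' : List ι → List ι → Matrix n n ℂ →ₗ[ℂ] Matrix n n ℂ}
    (hG : ∀ p q : List ι, p.length = k → q.length = k →
      ∀ u : List ι, u.length = m → G p q (word A u) = openSum A F k (q ++ u ++ p))
    (hG' : ∀ p q : List ι, p.length = k → q.length = k →
      ∀ u : List ι, u.length = m + 1 → G' p q (word A u) = openSum A F k (q ++ u ++ p)) :
    ∃ (B : List ι → Matrix n n ℂ) (c : ℂ), ∀ (a b : ι) (q q' : List ι), q.length = k →
      a :: q' = q ++ [b] → F (a :: q') = A a * B q' - B q * A b + c • word A (a :: q') := by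
  have hleft : ∀ (p q q' : List ι) (a b : ι), p.length = k → q.length = k →
      a :: q' = q ++ [b] → G' p q ∘ₗ LinearMap.mulLeft ℂ (A b)
        = LinearMap.mulLeft ℂ (A a) ∘ₗ G p q'
          + LinearMap.mulLeft ℂ (F (a :: q')) ∘ₗ LinearMap.mulRight ℂ (word A p) := by
    intro p q q' a b hp hq h
    have hq' : q'.length = k := by
      have := congrArg List.length h; simp at this; omega
    refine hm.linearMap_ext fun u hu => ?_
    have h1 := hG' p q hp hq (b :: u) (by simp [hu])
    have h2 : q ++ b :: u ++ p = a :: (q' ++ u ++ p) := by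
      rw [← List.singleton_append, ← List.append_assoc, ← h]; simp
    rw [h2, openSum_cons A F a (by simp; omega)] at h1
    have h3 : a :: (q' ++ u ++ p) = (a :: q') ++ (u ++ p) := by simp
    rw [h3, headTerm_append A F (by simp; omega)] at h1
    simp only [word_cons] at h1
    simp [h1, hG p q' hp hq' u hu, headTerm, ← hq']
  have hright : ∀ (p p' q : List ι) (a b : ι), p.length = k → q.length = k →
      a :: p' = p ++ [b] → G' p' q ∘ₗ LinearMap.mulRight ℂ (A a)
        = LinearMap.mulRight ℂ (A b) ∘ₗ G p q
          + LinearMap.mulLeft ℂ (word A q) ∘ₗ LinearMap.mulRight ℂ (F (a :: p')) := by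
    intro p p' q a b hp hq h
    have hp' : p'.length = k := by
      have := congrArg List.length h; simp at this; omega
    refine hm.linearMap_ext fun u hu => ?_
    have h1 := hG' p' q hp' hq (u ++ [a]) (by simp [hu])
    have h2 : q ++ (u ++ [a]) ++ p' = q ++ u ++ p ++ [b] := by
      rw [List.append_assoc _ p, ← h]; simp
    rw [h2, openSum_concat A F hp, ← h] at h1
    simp only [word_append, word_cons, word_nil, mul_one] at h1
    simp [h1, hG p q hp hq u hu, mul_assoc]
  let g : (List ι → List ι → Matrix n n ℂ →ₗ[ℂ] Matrix n n ℂ) → List ι → Matrix n n ℂ :=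
    fun H q => ∑ p : Fin k → ι, contract (H (List.ofFn p) q) (weight A P R (List.ofFn p))
  let f : ℂ := ∑ l : Fin (k + 1) → ι, (F (List.ofFn l) * weight A P R (List.ofFn l)).trace
  have hshift : ∀ q : List ι, q.length = k → g G' q = g G q + f • word A q := by
    intro q hq
    have key : ∀ l : Fin (k + 1) → ι,
        contract (G' (List.ofFn fun t : Fin k => l t.succ) q)
            (weight A P R (List.ofFn l) * A (l 0))
          = contract (G (List.ofFn fun t : Fin k => l t.castSucc) q)
              (A (l (Fin.last k)) * weight A P R (List.ofFn l))
            + (F (List.ofFn l) * weight A P R (List.ofFn l)).trace • word A q := by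
      intro l
      have h := hright (List.ofFn fun t : Fin k => l t.castSucc)
        (List.ofFn fun t : Fin k => l t.succ) q (l 0) (l (Fin.last k)) (by simp) hq
        (by rw [← ofFn_eq_cons, ← ofFn_eq_concat])
      rw [← contract_comp_mulRight, h, contract_add, contract_mulRight_comp,
        contract_mulLeft_comp, ← LinearMap.comp_id (LinearMap.mulRight ℂ (F _)),
        contract_mulRight_comp, contract_id, ← ofFn_eq_cons, mul_smul_comm, mul_one]
    have hsum := Finset.sum_congr (rfl : (Finset.univ : Finset (Fin (k + 1) → ι)) = _)
      fun l _ => key l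
    rw [Finset.sum_add_distrib, ← Finset.sum_smul, sum_fin_succ_eq_sum_cons,
      sum_fin_succ_eq_sum_snoc (M := Matrix n n ℂ)] at hsum
    simp only [ofFn_snoc, List.ofFn_cons, Fin.cons_zero, Fin.cons_succ, Fin.snoc_castSucc,
      Fin.snoc_last, ← contract_sum, sum_weight_cons_mul hPfix,
      sum_mul_weight_concat hRfix] at hsum
    exact hsum
  have hτ : (R * P).trace ≠ 0 := trace_mul_ne_zero_of_posDef hR hP
  refine ⟨fun q => -(R * P).trace⁻¹ • g G q, (R * P).trace⁻¹ * f, fun a b q q' hq h => ?_⟩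
  have key : ∀ p : Fin k → ι,
      contract (G' (List.ofFn p) q) (weight A P R (List.ofFn p)) * A b
        = A a * contract (G (List.ofFn p) q') (weight A P R (List.ofFn p))
          + (word A (List.ofFn p) * weight A P R (List.ofFn p)).trace • F (a :: q') := by
    intro p
    rw [← contract_comp_mulLeft, hleft _ q q' a b (by simp) hq h, contract_add,
      contract_mulLeft_comp, contract_mulLeft_comp,
      ← LinearMap.comp_id (LinearMap.mulRight ℂ (word A _)), contract_mulRight_comp, contract_id,
      mul_smul_comm, mul_one]
  have hsum := Finset.sum_congr (rfl : (Finset.univ : Finset (Fin k → ι)) = _) fun p _ => key p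
  rw [Finset.sum_add_distrib, ← Finset.sum_smul, ← Finset.sum_mul, ← Finset.mul_sum,
    sum_trace_word_mul_weight hRfix] at hsum
  change g G' q * A b = A a * g G q' + _ at hsum
  rw [hshift q hq, add_mul, smul_mul_assoc] at hsum
  have hw : word A q * A b = word A (a :: q') := by rw [h]; simp
  rw [hw] at hsum
  have hF : F (a :: q') = (R * P).trace⁻¹ • ((R * P).trace • F (a :: q')) := by
    rw [smul_smul, inv_mul_cancel₀ hτ, one_smul]
  rw [hF, ← sub_eq_of_eq_add' hsum]
  simp only [mul_smul_comm, smul_mul_assoc, mul_smul]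
  module

/-- On a ring, telescoping differences cancel, which fixes the multiple of the word. -/
lemma sum_trace_headTerm_of_telescoping {B : List ι → Matrix n n ℂ} {c : ℂ}
    (hB : ∀ (a b : ι) (q q' : List ι), q.length = k →
      a :: q' = q ++ [b] → F (a :: q') = A a * B q' - B q * A b + c • word A (a :: q'))
    (x : List ι) (hx : k + 1 ≤ x.length) :
    ∑ s ∈ Finset.range x.length, (headTerm A F k (x.rotate s)).trace
      = x.length * (c * (word A x).trace) := by
  let β : List ι → ℂ := fun y => (B (y.take k) * word A (y.drop k)).trace
  have hstep : ∀ y : List ι, k + 1 ≤ y.length →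
      (headTerm A F k y).trace = β (y.rotate 1) - β y + c * (word A y).trace := by
    intro y hy
    obtain ⟨l, z, rfl, hl⟩ : ∃ l z, y = l ++ z ∧ l.length = k + 1 :=
      ⟨y.take (k + 1), y.drop (k + 1), by simp, by simpa using hy⟩
    obtain ⟨a, q', rfl⟩ := List.exists_cons_of_length_eq_add_one hl
    obtain ⟨q, b, hqb⟩ : ∃ q b, a :: q' = q ++ [b] :=
      ⟨_, _, (List.dropLast_append_getLast (List.cons_ne_nil a q')).symm⟩
    have hq' : q'.length = k := by simpa using hl
    have hq : q.length = k := by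
      have := congrArg List.length hqb; simp at this; omega
    have h1 : β ((a :: q' ++ z).rotate 1) = (A a * B q' * word A z).trace := by
      simp only [β, List.cons_append, List.rotate_cons_succ, List.rotate_zero]
      rw [List.append_assoc, List.take_left' hq', List.drop_left' hq', word_append, word_cons,
        word_nil, mul_one, ← mul_assoc, Matrix.trace_mul_comm, mul_assoc]
    have h2 : β (a :: q' ++ z) = (B q * A b * word A z).trace := by
      simp only [β]
      rw [hqb, List.append_assoc, List.take_left' hq, List.drop_left' hq, word_append, word_cons,
        word_nil, mul_one, ← mul_assoc]
    rw [h1, h2, headTerm, List.take_left' hl, List.drop_left' hl, hB a b q q' hq hqb, word_append]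
    simp only [add_mul, sub_mul, Matrix.trace_add, Matrix.trace_sub, smul_mul_assoc,
      Matrix.trace_smul, smul_eq_mul]
  calc ∑ s ∈ Finset.range x.length, (headTerm A F k (x.rotate s)).trace
      = ∑ s ∈ Finset.range x.length,
          ((β (x.rotate (s + 1)) - β (x.rotate s)) + c * (word A x).trace) :=
        Finset.sum_congr rfl fun s _ => by
          rw [hstep _ (by simpa using hx), List.rotate_rotate, trace_word_rotate]
    _ = x.length * (c * (word A x).trace) := by
        rw [Finset.sum_add_distrib, Finset.sum_range_sub fun s => β (x.rotate s)]
        simp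

/-- A block whose cyclic sums vanish on a long enough ring is a telescoping difference. -/
lemma exists_telescoping [Fintype ι] [Nonempty n] {P R : Matrix n n ℂ} (hP : P.PosDef)
    (hR : R.PosDef) (hPfix : ∑ a, (A a)ᴴ * P * A a = P) (hRfix : ∑ a, A a * R * (A a)ᴴ = R)
    {L N : ℕ} (hL : Separates A L) (hN : 2 * L + 2 * k + 1 ≤ N)
    (hcyc : ∀ x : List ι, x.length = N →
      ∑ s ∈ Finset.range N, (headTerm A F k (x.rotate s)).trace = 0) :
    ∃ B : List ι → Matrix n n ℂ, ∀ (a b : ι) (q q' : List ι), q.length = k →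
      a :: q' = q ++ [b] → F (a :: q') = A a * B q' - B q * A b := by
  have hsep : ∀ m, L ≤ m → Separates A m := fun m hm => hL.of_le hR.isUnit hRfix hm
  choose G hG using exists_linearMap_openSum hcyc hL (hsep (N - 2 * k - L) (by omega)) (by omega)
  choose G' hG' using exists_linearMap_openSum hcyc (hsep (L + 1) (by omega))
    (hsep (N - 2 * k - (L + 1)) (by omega)) (by omega)
  obtain ⟨B, c, hB⟩ := exists_telescoping_add_smul hP hR hPfix hRfix hL hG hG'
  have hc : c = 0 := by
    by_contra hc
    refine one_ne_zero (α := Matrix n n ℂ) (hsep N (by omega) 1 fun w => ?_)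
    have h := sum_trace_headTerm_of_telescoping hB w.1 (by rw [w.2]; omega)
    rw [w.2, hcyc _ w.2] at h
    have hN0 : (N : ℂ) ≠ 0 := by
      rw [Nat.cast_ne_zero]; omega
    simpa [hc, hN0] using h.symm
  refine ⟨B, fun a b q q' hq h => ?_⟩
  rw [hB a b q q' hq h, hc, zero_smul, add_zero]

end Telescoping

section Ring

variable {d D N : ℕ}

lemma prodA_eq_word (A : Fin d → Matrix (Fin D) (Fin D) ℂ) {m : ℕ} (i : Fin m → Fin d) :
    prodA A i = word A (List.ofFn i) := by
  simp [prodA, word, List.map_ofFn, Function.comp_def]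

lemma cyc_injective (a : Fin N) : Function.Injective fun t : Fin N => cyc a t.val := by
  intro s t h
  have h1 : a.val + s.val ≡ a.val + t.val [MOD N] := congrArg Fin.val h
  exact Fin.ext (Nat.ModEq.eq_of_lt_of_lt (Nat.ModEq.add_left_cancel' _ h1) s.isLt t.isLt)

/-- Translation of the sites by `a`, as a permutation. -/
noncomputable def cycEquiv (a : Fin N) : Fin N ≃ Fin N :=
  Equiv.ofBijective _ (Finite.injective_iff_bijective.mp (cyc_injective a))

lemma cycEquiv_apply (a t : Fin N) : cycEquiv a t = cyc a t.val := rfl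

lemma rotate_ofFn {α : Type*} (x : Fin N → α) (a : Fin N) :
    (List.ofFn x).rotate a = List.ofFn (x ∘ cycEquiv a) := by
  refine List.ext_getElem (by simp) fun t h1 h2 => ?_
  simp only [List.getElem_rotate, List.getElem_ofFn, List.length_ofFn, Function.comp_apply,
    cycEquiv_apply, cyc, add_comm]

lemma localOp_mulVec_mps {k r : ℕ} (A : Fin d → Matrix (Fin D) (Fin D) ℂ)
    (o : Matrix (Fin (k + 1) → Fin d) (Fin (k + 1) → Fin d) ℂ) (a : Fin (k + 1 + r))
    (x : Fin (k + 1 + r) → Fin d) :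
    (localOp o a).mulVec (mps A (k + 1 + r)) x
      = ((∑ j, o (fun t => x (cycEquiv a (Fin.castAdd r t))) j • prodA A j)
          * word A (List.ofFn fun t : Fin r => x (cycEquiv a (Fin.natAdd (k + 1) t)))).trace := by
  have hmps : ∀ z, mps A (k + 1 + r) (z ∘ (cycEquiv a).symm) = (word A (List.ofFn z)).trace := by
    intro z
    rw [mps, prodA_eq_word, ← trace_word_rotate A _ a, rotate_ofFn]
    simp [Function.comp_def]
  have hloc : ∀ (j : Fin (k + 1) → Fin d) (z : Fin r → Fin d),
      localOp o a x (Fin.append j z ∘ (cycEquiv a).symm)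
        = if z = fun t => x (cycEquiv a (Fin.natAdd (k + 1) t)) then
            o (fun t => x (cycEquiv a (Fin.castAdd r t))) j else 0 := by
    intro j z
    have hj : (fun t : Fin (k + 1) =>
        (Fin.append j z ∘ (cycEquiv a).symm) (cyc a t.val)) = j := by
      funext t
      change Fin.append j z ((cycEquiv a).symm (cycEquiv a (Fin.castAdd r t))) = j t
      simp
    have hiff : (∀ m, (∀ t : Fin (k + 1), m ≠ cyc a t.val) →
        x m = (Fin.append j z ∘ (cycEquiv a).symm) m)
          ↔ z = fun t => x (cycEquiv a (Fin.natAdd (k + 1) t)) := by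
      constructor
      · intro h
        funext t
        rw [h]
        · simp
        · intro s hs
          have := (cycEquiv a).injective (hs.trans (cycEquiv_apply a (Fin.castAdd r s)).symm)
          have := congrArg Fin.val this
          simp at this
          omega
      · rintro rfl m hm
        obtain ⟨s, rfl⟩ := (cycEquiv a).surjective m
        induction s using Fin.addCases with
        | left s => exact absurd rfl (hm s)
        | right s => simp
    simp only [localOp, Matrix.of_apply, hj, hiff, mul_ite, mul_one, mul_zero]
    rfl
  rw [Matrix.mulVec, dotProduct, ← ((cycEquiv a).arrowCongr (Equiv.refl (Fin d))).sum_comp,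
    ← (Fin.appendEquiv (k + 1) r).sum_comp, Fintype.sum_prod_type, Finset.sum_mul,
    Matrix.trace_sum]
  refine Finset.sum_congr rfl fun j _ => ?_
  have : ∀ z : Fin r → Fin d, (cycEquiv a).arrowCongr (Equiv.refl (Fin d))
      (Fin.appendEquiv (k + 1) r (j, z)) = Fin.append j z ∘ (cycEquiv a).symm := fun z => rfl
  simp only [this, hmps, hloc, ite_mul, zero_mul, Finset.sum_ite_eq', Finset.mem_univ, if_true,
    List.ofFn_fin_append, word_append, prodA_eq_word, smul_mul_assoc, Matrix.trace_smul, smul_eq_mul]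

/-- The defect `∑ j, o i j • A^j - ε • A^i` as a function of the list of letters of `i`. -/
noncomputable def defect {k : ℕ} (A : Fin d → Matrix (Fin D) (Fin D) ℂ)
    (o : Matrix (Fin (k + 1) → Fin d) (Fin (k + 1) → Fin d) ℂ) (ε : ℂ) (a₀ : Fin d)
    (l : List (Fin d)) : Matrix (Fin D) (Fin D) ℂ :=
  (∑ j, o (fun t => l.getD t a₀) j • prodA A j) - ε • word A l

lemma defect_ofFn {k : ℕ} (A : Fin d → Matrix (Fin D) (Fin D) ℂ)
    (o : Matrix (Fin (k + 1) → Fin d) (Fin (k + 1) → Fin d) ℂ) (ε : ℂ) (a₀ : Fin d)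
    (i : Fin (k + 1) → Fin d) :
    defect A o ε a₀ (List.ofFn i) = (∑ j, o i j • prodA A j) - ε • prodA A i := by
  have h : (fun t : Fin (k + 1) => (List.ofFn i).getD t a₀) = i := by
    funext t
    simp [List.getD_eq_getElem?_getD, -List.ofFn_succ, Fin.is_le t]
  rw [defect, h, prodA_eq_word A i]

lemma sum_trace_headTerm_defect {k r : ℕ} (A : Fin d → Matrix (Fin D) (Fin D) ℂ)
    (o : Matrix (Fin (k + 1) → Fin d) (Fin (k + 1) → Fin d) ℂ) (a₀ : Fin d) {E : ℂ}
    (heig : (opSum (N := k + 1 + r) o).mulVec (mps A _) = E • mps A _)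
    (x : List (Fin d)) (hx : x.length = k + 1 + r) :
    ∑ s ∈ Finset.range (k + 1 + r),
      (headTerm A (defect A o (E / (k + 1 + r : ℕ)) a₀) k (x.rotate s)).trace = 0 := by
  obtain ⟨x, rfl⟩ : ∃ x' : Fin (k + 1 + r) → Fin d, x = List.ofFn x' :=
    ⟨fun t => x[t.val]'(by rw [hx]; exact t.isLt), List.ext_getElem (by simp [hx]) (by simp)⟩
  have hterm : ∀ a : Fin (k + 1 + r),
      (headTerm A (defect A o (E / (k + 1 + r : ℕ)) a₀) k ((List.ofFn x).rotate a)).trace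
        = (localOp o a).mulVec (mps A _) x - E / (k + 1 + r : ℕ) * mps A _ x := by
    intro a
    have hsplit : (List.ofFn x).rotate a
        = List.ofFn (fun t => x (cycEquiv a (Fin.castAdd r t)))
          ++ List.ofFn fun t : Fin r => x (cycEquiv a (Fin.natAdd (k + 1) t)) := by
      rw [rotate_ofFn, ← List.ofFn_fin_append]
      congr 1
      funext t
      induction t using Fin.addCases <;> simp
    rw [localOp_mulVec_mps, mps, prodA_eq_word A x, ← trace_word_rotate A _ a, hsplit, headTerm,
      List.take_left' (by simp), List.drop_left' (by simp), defect_ofFn, sub_mul,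
      Matrix.trace_sub, word_append, smul_mul_assoc, Matrix.trace_smul, smul_eq_mul,
      prodA_eq_word A (fun t => x _)]
  rw [Finset.sum_range, Finset.sum_congr rfl fun a _ => hterm a, Finset.sum_sub_distrib]
  have h := congrFun heig x
  rw [opSum, Matrix.sum_mulVec, Finset.sum_apply] at h
  rw [h]
  have h0 : ((k + 1 + r : ℕ) : ℂ) ≠ 0 := by rw [Nat.cast_ne_zero]; omega
  simp only [Pi.smul_apply, smul_eq_mul, Finset.sum_const, Finset.card_univ, Fintype.card_fin,
    nsmul_eq_mul]
  field_simp
  ring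

lemma InjectiveLen.separates {L : ℕ} {A : Fin d → Matrix (Fin D) (Fin D) ℂ}
    (h : InjectiveLen A L) : Separates A L := by
  intro X hX
  refine h (funext fun i => ?_)
  simpa [prodA_eq_word] using hX ⟨List.ofFn i, by simp⟩

end Ring

end MPS

/-- If an injective MPS (with positive definite transfer fixed
points) on `N > 2L + 2k − 1` sites is an eigenstate of `O_N` with eigenvalue `E_N`,
then, with `ε := E_N / N`, the local telescoping equation has a solution `B`. -/
theorem telescopes_of_mps_eigenstate
    (d D : ℕ) (hd : 1 ≤ d) (hD : 1 ≤ D)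
    (A : Fin d → Matrix (Fin D) (Fin D) ℂ)
    (L : ℕ) (hinj : InjectiveLen A L)
    (ρL ρR : Matrix (Fin D) (Fin D) ℂ) (hfix : TransferFixedPoints A ρL ρR)
    (k : ℕ) (o : Matrix (Fin (k+1) → Fin d) (Fin (k+1) → Fin d) ℂ)
    (E : ℂ) (N : ℕ) (hN : 2 * L + 2 * k + 1 < N)
    (heig : (opSum (N := N) o).mulVec (mps A N) = E • mps A N) :
    ∃ B : (Fin k → Fin d) → Matrix (Fin D) (Fin D) ℂ,
      Telescopes A o (E / (N : ℂ)) B := by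
  obtain ⟨hP, hR, hPfix, hRfix⟩ := hfix
  have : Nonempty (Fin D) := ⟨⟨0, hD⟩⟩
  obtain ⟨r, rfl⟩ : ∃ r, N = k + 1 + r := ⟨N - (k + 1), by omega⟩
  obtain ⟨B, hB⟩ := MPS.exists_telescoping (k := k) hP hR hPfix hRfix
    (MPS.InjectiveLen.separates hinj) hN.le (MPS.sum_trace_headTerm_defect A o ⟨0, hd⟩ heig)
  refine ⟨fun q => B (List.ofFn q), fun i => ?_⟩
  rw [← MPS.defect_ofFn A o _ ⟨0, hd⟩ i, MPS.ofFn_eq_cons]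
  exact hB _ _ _ _ (by simp) (by rw [← MPS.ofFn_eq_cons, MPS.ofFn_eq_concat])
end

section
/- Let A be any MPS tensor (no injectivity assumed), o a k-site operator (k ≥ 1), ε ∈ ℂ, and suppose there exists a family B = (B^{i_1…i_{k−1}}) of D×D complex matrices satisfying the local telescoping equation for (A, o, ε). Then for every N ≥ k, the matrix product state ψ_N satisfies O_N ψ_N = (N·ε) ψ_N. -/
open Matrix
open scoped ComplexOrder

/-- The product `A^{f a} A^{f (a+1)} ⋯ A^{f (a+l-1)}` along a segment of a sequence. -/
noncomputable def segProd {d D : ℕ} (A : Fin d → Matrix (Fin D) (Fin D) ℂ)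
    (f : ℕ → Fin d) (a l : ℕ) : Matrix (Fin D) (Fin D) ℂ :=
  ((List.range l).map fun t => A (f (a + t))).prod

section SegProd

variable {d D : ℕ} (A : Fin d → Matrix (Fin D) (Fin D) ℂ)

lemma prodA_eq_segProd (f : ℕ → Fin d) (a l : ℕ) :
    prodA A (fun t : Fin l => f (a + t)) = segProd A f a l := by
  unfold prodA segProd
  congr 1
  apply List.ext_getElem <;> simp

lemma segProd_add (f : ℕ → Fin d) (a l m : ℕ) :
    segProd A f a (l + m) = segProd A f a l * segProd A f (a + l) m := by
  simp [segProd, List.range_add, Function.comp_def, add_assoc]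

lemma segProd_one (f : ℕ → Fin d) (a : ℕ) : segProd A f a 1 = A (f a) := by
  simp [segProd]

lemma segProd_congr {f g : ℕ → Fin d} {a l : ℕ}
    (h : ∀ t < l, f (a + t) = g (a + t)) : segProd A f a l = segProd A g a l := by
  unfold segProd
  congr 1
  refine List.map_congr_left fun t ht => ?_
  rw [h t (List.mem_range.mp ht)]

lemma trace_segProd_of_periodic {f : ℕ → Fin d} {N : ℕ} (hN : 1 ≤ N)
    (hf : Function.Periodic f N) (a : ℕ) :
    (segProd A f a N).trace = (segProd A f 0 N).trace := by
  induction a with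
  | zero => rfl
  | succ a ih =>
    rw [← ih]
    obtain ⟨M, rfl⟩ := Nat.exists_eq_add_of_le hN
    rw [segProd_add A f a 1 M, Nat.add_comm 1 M, segProd_add, segProd_one, segProd_one,
      Matrix.trace_mul_comm, show a + 1 + M = a + (1 + M) by omega, hf a]

end SegProd

/-- The periodic extension of a configuration on a ring of sites. -/
def periodicExt {α : Type*} {N : ℕ} (hN : 0 < N) (x : Fin N → α) (m : ℕ) : α :=
  x ⟨m % N, Nat.mod_lt _ hN⟩

lemma periodicExt_periodic {α : Type*} {N : ℕ} (hN : 0 < N) (x : Fin N → α) :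
    Function.Periodic (periodicExt hN x) N := by
  intro m
  simp [periodicExt]

lemma apply_cyc {α : Type*} {N : ℕ} (hN : 0 < N) (x : Fin N → α) (n : Fin N) (t : ℕ) :
    x (cyc n t) = periodicExt hN x (n + t) := rfl

lemma mps_eq_trace_segProd {d D N : ℕ} (A : Fin d → Matrix (Fin D) (Fin D) ℂ)
    (hN : 0 < N) (x : Fin N → Fin d) (a : ℕ) :
    mps A N x = (segProd A (periodicExt hN x) a N).trace := by
  rw [trace_segProd_of_periodic A hN (periodicExt_periodic hN x), ← prodA_eq_segProd]
  simp [mps, periodicExt, Nat.mod_eq_of_lt]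

lemma cyc_inj {N : ℕ} {n : Fin N} {s t : ℕ} (hs : s < N) (ht : t < N)
    (h : cyc n s = cyc n t) : s = t :=
  Nat.ModEq.eq_of_lt_of_lt (Nat.ModEq.add_left_cancel' n.val (congrArg Fin.val h)) hs ht

/-- A sum over the configurations that agree with `x` off the block of `k` sites starting at `n`
is a sum over the configurations of the block. -/
lemma sum_agree_off_block {d k N : ℕ} (hk : k ≤ N) (x : Fin N → Fin d) (n : Fin N)
    (F : (Fin k → Fin d) → ℂ) :
    ∑ y : Fin N → Fin d, (if ∀ m : Fin N, (∀ t : Fin k, m ≠ cyc n t.val) → x m = y m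
        then F (fun t => y (cyc n t.val)) else 0) = ∑ j, F j := by
  classical
  have hinj : Function.Injective fun t : Fin k => cyc n t.val := fun s t h =>
    Fin.ext (cyc_inj (s.isLt.trans_le hk) (t.isLt.trans_le hk) h)
  rw [← Finset.sum_filter]
  refine Finset.sum_nbij' (fun y t => y (cyc n t.val))
    (fun j => Function.extend (fun t : Fin k => cyc n t.val) j x) ?_ ?_ ?_ ?_ ?_
  · simp
  · intro j _
    simp only [Finset.mem_filter, Finset.mem_univ, true_and]
    intro m hm
    rw [Function.extend_apply' _ _ _ fun ⟨t, ht⟩ => hm t ht.symm]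
  · intro y hy
    simp only [Finset.mem_filter, Finset.mem_univ, true_and] at hy
    funext m
    by_cases h : ∃ t : Fin k, cyc n t.val = m
    · obtain ⟨t, rfl⟩ := h
      exact hinj.extend_apply _ _ t
    · rw [Function.extend_apply' _ _ _ h]
      exact hy m fun t ht => h ⟨t, ht.symm⟩
  · intro j _
    funext t
    exact hinj.extend_apply _ _ t
  · simp

/-- If `y` agrees with `x` off the block starting at `n`, its amplitude splits into the block
product of `y` and the complementary product of `x`. -/
lemma mps_eq_trace_block_mul {d D k N : ℕ} (A : Fin d → Matrix (Fin D) (Fin D) ℂ)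
    (hN : 0 < N) (hk : k ≤ N) {x y : Fin N → Fin d} {n : Fin N}
    (h : ∀ m : Fin N, (∀ t : Fin k, m ≠ cyc n t.val) → x m = y m) :
    mps A N y = (prodA A (fun t : Fin k => y (cyc n t.val)) *
      segProd A (periodicExt hN x) (n + k) (N - k)).trace := by
  have hsplit := segProd_add A (periodicExt hN y) n k (N - k)
  rw [Nat.add_sub_of_le hk, ← prodA_eq_segProd A _ _ k] at hsplit
  rw [mps_eq_trace_segProd A hN y n, hsplit]
  congr 2
  refine segProd_congr A fun t ht => ?_
  rw [add_assoc, ← apply_cyc hN, ← apply_cyc hN, h]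
  intro s hs
  have := cyc_inj (by omega) (s.isLt.trans_le hk) hs
  have := s.isLt
  omega

lemma localOp_mulVec_mps {d D k N : ℕ} (A : Fin d → Matrix (Fin D) (Fin D) ℂ)
    (o : Matrix (Fin k → Fin d) (Fin k → Fin d) ℂ) (hN : 0 < N) (hk : k ≤ N)
    (n : Fin N) (x : Fin N → Fin d) :
    (localOp o n).mulVec (mps A N) x =
      ((∑ j, o (fun t => x (cyc n t.val)) j • prodA A j) *
        segProd A (periodicExt hN x) (n + k) (N - k)).trace := by
  rw [Finset.sum_mul, Matrix.trace_sum, ← sum_agree_off_block hk x n]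
  refine Finset.sum_congr rfl fun y _ => ?_
  simp only [localOp, Matrix.of_apply]
  split_ifs with h
  · rw [mps_eq_trace_block_mul A hN hk h]
    simp
  · simp

/-- On a telescoping local term, `o_n - ε` acts on the matrix product state as the increment of
an amplitude with `B` inserted. -/
lemma localOp_mulVec_mps_of_telescopes {d D k N : ℕ} {A : Fin d → Matrix (Fin D) (Fin D) ℂ}
    {o : Matrix (Fin (k + 1) → Fin d) (Fin (k + 1) → Fin d) ℂ} {ε : ℂ}
    {B : (Fin k → Fin d) → Matrix (Fin D) (Fin D) ℂ} (hB : Telescopes A o ε B)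
    (hN : 0 < N) (hk : k + 1 ≤ N) (x : Fin N → Fin d) (g : ℕ → ℂ)
    (hg : ∀ a, g a = (B (fun t => periodicExt hN x (a + t)) *
      segProd A (periodicExt hN x) (a + k) (N - k)).trace) (n : Fin N) :
    (localOp o n).mulVec (mps A N) x = ε * mps A N x + (g (n + 1) - g n) := by
  have hx := hB fun t => x (cyc n t.val)
  rw [sub_eq_iff_eq_add'] at hx
  rw [localOp_mulVec_mps A o hN hk, hx, add_mul, sub_mul, Matrix.trace_add, Matrix.trace_sub,
    Matrix.smul_mul, Matrix.trace_smul, ← mps_eq_trace_block_mul A hN hk (fun _ _ => rfl),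
    smul_eq_mul, hg, hg]
  have hf := periodicExt_periodic hN x
  simp only [apply_cyc hN, Fin.val_zero, Fin.val_succ, Fin.val_castSucc, Fin.val_last]
  set f := periodicExt hN x
  obtain ⟨M, rfl⟩ := Nat.exists_eq_add_of_le hk
  have h1 : k + 1 + M - (k + 1) = M := by omega
  have h2 : k + 1 + M - k = 1 + M := by omega
  rw [h1, h2]
  congr 2
  · rw [mul_assoc, Matrix.trace_mul_comm, mul_assoc, Nat.add_comm 1 M, segProd_add A f _ M 1,
      segProd_one, show n.val + 1 + k + M = n + (k + 1 + M) by omega, hf n]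
    simp only [add_zero, add_comm, add_left_comm]
  · rw [segProd_add, segProd_one, mul_assoc]
    rfl

/-- If the local telescoping equation for `(A, o, ε)` has a
solution `B` (no injectivity assumed), then for every `N ≥ k` (the size `k+1` of
`o` here) the MPS on `N` sites is an eigenstate of `O_N` with eigenvalue `N ε`. -/
theorem mps_eigenstate_of_telescopes
    (d D : ℕ) (hd : 1 ≤ d) (hD : 1 ≤ D)
    (A : Fin d → Matrix (Fin D) (Fin D) ℂ)
    (k : ℕ) (o : Matrix (Fin (k+1) → Fin d) (Fin (k+1) → Fin d) ℂ) (ε : ℂ)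
    (B : (Fin k → Fin d) → Matrix (Fin D) (Fin D) ℂ)
    (hB : Telescopes A o ε B) :
    ∀ N : ℕ, k + 1 ≤ N →
      (opSum (N := N) o).mulVec (mps A N) = ((N : ℂ) * ε) • mps A N := by
  intro N hk
  have hN : 0 < N := by omega
  funext x
  let g : ℕ → ℂ := fun a => (B (fun t => periodicExt hN x (a + t)) *
    segProd A (periodicExt hN x) (a + k) (N - k)).trace
  have hper : g N = g 0 := by
    have hf := periodicExt_periodic hN x
    have hs : ∀ m, periodicExt hN x (N + m) = periodicExt hN x m := fun m => by
      rw [add_comm, hf m]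
    simp [g, segProd, add_assoc, hs]
  rw [opSum, Matrix.sum_mulVec, Finset.sum_apply]
  simp only [localOp_mulVec_mps_of_telescopes hB hN hk x g fun _ => rfl]
  rw [Finset.sum_add_distrib, Fin.sum_univ_eq_sum_range (fun m => g (m + 1) - g m),
    Finset.sum_range_sub, hper]
  simp [mul_assoc]
end
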